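/- arXiv:2108.07066 — 2 statements merged into one kernel-verified Lean document; each statement's English description precedes it below -/
import Mathlib

section
/- For every integer s ≥ 1 there exists an integer d ≥ 0 such that every H_s-free finite simple graph G with at least one vertex is (ω^d, ω^{s+8})-colourable, where ω = ω(G), and hence has chromatic number at most ω^d·(ω^{s+8}+1). -/
open SimpleGraph Set

/-- `G` contains no induced subgraph isomorphic to `H`. -/
def IsInducedFree {V : Type*} {W : Type*} (G : SimpleGraph V) (H : SimpleGraph W) : Prop :=
  ∀ s : Set V, ¬ Nonempty ((G.induce s) ≃g H)

/-- The double star `H_s`: two adjacent internal vertices `0` and `1`; `0` is adjacent to the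
`s` leaves `2,…,s+1` and `1` is adjacent to the `s` leaves `s+2,…,2s+1`. -/
def doubleStarGraph (s : ℕ) : SimpleGraph (Fin (2*s+2)) :=
  SimpleGraph.fromRel (fun a b =>
    ((a : ℕ) = 0 ∧ (b : ℕ) = 1) ∨
    ((a : ℕ) = 0 ∧ 2 ≤ (b : ℕ) ∧ (b : ℕ) ≤ s+1) ∨
    ((a : ℕ) = 1 ∧ s+2 ≤ (b : ℕ)))

/-- A graph has degeneracy at most `d` if every nonempty subgraph has a vertex whose degree
in that subgraph is at most `d`. -/
def DegeneracyAtMost {V : Type*} (G : SimpleGraph V) (d : ℕ) : Prop :=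
  ∀ H : G.Subgraph, H.verts.Nonempty → ∃ v ∈ H.verts, (H.neighborSet v).ncard ≤ d

/-- A `(k,d)`-colouring: a partition of the vertex set into `k` parts, each inducing a
subgraph of degeneracy at most `d`. -/
def KDColorable {V : Type*} (G : SimpleGraph V) (k d : ℕ) : Prop :=
  ∃ f : V → Fin k, ∀ i : Fin k, DegeneracyAtMost (G.induce {v | f v = i}) d

/-- `G` contains the complete bipartite graph `K_{t,t}` as a (not necessarily induced)
subgraph. -/
def ContainsKtt {V : Type*} (G : SimpleGraph V) (t : ℕ) : Prop :=
  ∃ A B : Finset V, A.card = t ∧ B.card = t ∧ Disjoint A B ∧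
    ∀ a ∈ A, ∀ b ∈ B, G.Adj a b

/-- A set of vertices is stable (independent) if no two of its members are adjacent. -/
def IsStableSet {V : Type*} (G : SimpleGraph V) (S : Set V) : Prop :=
  ∀ a ∈ S, ∀ b ∈ S, a ≠ b → ¬ G.Adj a b

/-- An `s`-template in `G`: a clique `L0` complete to all the `L i`, pairwise disjoint sets
`L 1, …, L k` (here indexed by `Fin k`) whose sizes lie between `ω^{s+5}` and `14 ω^{s+6}`,
such that each vertex of `L i` has at most `ω^{s+3}` non-neighbours in each other `L j`. -/
def IsTemplate {V : Type*} (G : SimpleGraph V) (s : ℕ) (L0 : Set V) {k : ℕ}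
    (L : Fin k → Set V) : Prop :=
  (∀ i : Fin k, Disjoint L0 (L i)) ∧
  (Pairwise fun i j : Fin k => Disjoint (L i) (L j)) ∧
  G.IsClique L0 ∧
  (∀ u ∈ L0, ∀ i : Fin k, ∀ v ∈ L i, G.Adj u v) ∧
  (∀ i : Fin k, G.cliqueNum ^ (s+5) ≤ (L i).ncard ∧ (L i).ncard ≤ 14 * G.cliqueNum ^ (s+6)) ∧
  (∀ i j : Fin k, i ≠ j → ∀ v ∈ L i,
    ({u ∈ L j | ¬ G.Adj v u}).ncard ≤ G.cliqueNum ^ (s+3))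

/-- The value of an `s`-template. -/
noncomputable def templateValue {V : Type*} (G : SimpleGraph V) (s : ℕ) (L0 : Set V) {k : ℕ}
    (L : Fin k → Set V) : ℕ :=
  (⋃ i, L i).ncard + 7 * G.cliqueNum ^ (s+5) * L0.ncard + k * G.cliqueNum ^ (s+5)

/-- An optimal `s`-template: one of maximum value among all `s`-templates in `G`. -/
def IsOptimalTemplate {V : Type*} (G : SimpleGraph V) (s : ℕ) (L0 : Set V) {k : ℕ}
    (L : Fin k → Set V) : Prop :=
  IsTemplate G s L0 L ∧
  ∀ (k' : ℕ) (L0' : Set V) (L' : Fin k' → Set V), IsTemplate G s L0' L' →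
    templateValue G s L0' L' ≤ templateValue G s L0 L

/-- `V(𝓛)`, the vertex set of a template. -/
def templateVerts {V : Type*} (L0 : Set V) {k : ℕ} (L : Fin k → Set V) : Set V :=
  L0 ∪ ⋃ i, L i

/-- `N(𝓛)`: the vertices outside `V(𝓛)` with a neighbour in `L 1 ∪ ⋯ ∪ L k`. -/
def templateNbhd {V : Type*} (G : SimpleGraph V) (L0 : Set V) {k : ℕ}
    (L : Fin k → Set V) : Set V :=
  {v | v ∉ templateVerts L0 L ∧ ∃ i : Fin k, ∃ u ∈ L i, G.Adj v u}


/-- A vertex `v` is pendant with respect to the template: there are distinct `i, j`, a vertex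
`u ∈ L j` and a stable set `S ⊆ L i` of `s+1` common neighbours of `u` such that `v` is not
adjacent to `u` and `v` has exactly one neighbour in `S`. -/
def TemplatePendant {V : Type*} (G : SimpleGraph V) (s : ℕ) {k : ℕ}
    (L : Fin k → Set V) (v : V) : Prop :=
  ∃ i j : Fin k, i ≠ j ∧ ∃ u ∈ L j, ∃ S : Set V, S ⊆ L i ∧ S.ncard = s + 1 ∧
    IsStableSet G S ∧ (∀ w ∈ S, G.Adj u w) ∧ ¬ G.Adj v u ∧ ({w ∈ S | G.Adj v w}).ncard = 1

/-- A vertex `v` is dense with respect to the template: there are `j` and `u ∈ L j` such that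
for all `i ≠ j`, fewer than `ω^{s+2}/14` vertices of `L i` are adjacent to `u` and not to `v`. -/
def TemplateDense {V : Type*} (G : SimpleGraph V) (s : ℕ) {k : ℕ}
    (L : Fin k → Set V) (v : V) : Prop :=
  ∃ j : Fin k, ∃ u ∈ L j, ∀ i : Fin k, i ≠ j →
    14 * ({w ∈ L i | G.Adj u w ∧ ¬ G.Adj v w}).ncard < G.cliqueNum ^ (s+2)

/-- A vertex `v` is pure with respect to the template: it has no neighbour in at least two of
the sets `L i`, and for each `i`, either it has no neighbour in `L i` or it has at most
`ω^{s+2}/7` non-neighbours in `L i`. -/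
def TemplatePure {V : Type*} (G : SimpleGraph V) (s : ℕ) {k : ℕ}
    (L : Fin k → Set V) (v : V) : Prop :=
  (∃ i₁ i₂ : Fin k, i₁ ≠ i₂ ∧ (∀ w ∈ L i₁, ¬ G.Adj v w) ∧ (∀ w ∈ L i₂, ¬ G.Adj v w)) ∧
  (∀ i : Fin k, (∀ w ∈ L i, ¬ G.Adj v w) ∨
    7 * ({w ∈ L i | ¬ G.Adj v w}).ncard ≤ G.cliqueNum ^ (s+2))

/-- `M_I`: the pure vertices `v` (with respect to the template) whose set `I_v` of indices `i`
such that `v` has a neighbour in `L i` equals `I`. -/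
def templatePart {V : Type*} (G : SimpleGraph V) (s : ℕ) (L0 : Set V) {k : ℕ}
    (L : Fin k → Set V) (I : Set (Fin k)) : Set V :=
  {v | v ∈ templateNbhd G L0 L ∧ TemplatePure G s L v ∧
    ∀ i : Fin k, (∃ u ∈ L i, G.Adj v u) ↔ i ∈ I}

/-- Two disjoint sets `A, B` are `s`-crowded if there is no stable set meeting each of them
in exactly `s` vertices. -/
def SCrowded {V : Type*} (G : SimpleGraph V) (s : ℕ) (A B : Set V) : Prop :=
  ¬ ∃ X : Set V, IsStableSet G X ∧ (X ∩ A).ncard = s ∧ (X ∩ B).ncard = s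

/-- `c` satisfies the Kővári–Sós–Turán-type bound for `H_s`: every `H_s`-free graph either
contains `K_{t,t}` as a subgraph or has degeneracy less than `t^c`. -/
def KSTBound (s c : ℕ) : Prop :=
  ∀ (W : Type) [Fintype W], ∀ G' : SimpleGraph W, IsInducedFree G' (doubleStarGraph s) →
    ∀ t : ℕ, ContainsKtt G' t ∨ ∃ D : ℕ, D < t ^ c ∧ DegeneracyAtMost G' D

/-- `Z(𝓛)`: the union of `L0` with the set of vertices of `N(𝓛)` having at most `ω^{s+2}/4`
non-neighbours in each `L i`. -/
def templateZ {V : Type*} (G : SimpleGraph V) (s : ℕ) (L0 : Set V) {k : ℕ}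
    (L : Fin k → Set V) : Set V :=
  L0 ∪ {v ∈ templateNbhd G L0 L |
    ∀ i : Fin k, 4 * ({u ∈ L i | ¬ G.Adj v u}).ncard ≤ G.cliqueNum ^ (s+2)}

/-- `Y(𝓛) = (V(𝓛) ∪ N(𝓛)) \ Z(𝓛)`. -/
def templateY {V : Type*} (G : SimpleGraph V) (s : ℕ) (L0 : Set V) {k : ℕ}
    (L : Fin k → Set V) : Set V :=
  (templateVerts L0 L ∪ templateNbhd G L0 L) \ templateZ G s L0 L

/-- `N_A(𝓛)`: the vertices of `A \ V(𝓛)` with a neighbour in `L 1 ∪ ⋯ ∪ L k`. -/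
def templateNbhdIn {V : Type*} (G : SimpleGraph V) (A : Set V) (L0 : Set V) {k : ℕ}
    (L : Fin k → Set V) : Set V :=
  {v ∈ A | v ∉ templateVerts L0 L ∧ ∃ i : Fin k, ∃ u ∈ L i, G.Adj v u}

/-- `Z_A(𝓛)`: the union of `L0` with the set of vertices of `A \ V(𝓛)` having at most
`ω^{s+2}/4` non-neighbours in each `L i`. -/
def templateZIn {V : Type*} (G : SimpleGraph V) (s : ℕ) (A : Set V) (L0 : Set V) {k : ℕ}
    (L : Fin k → Set V) : Set V :=
  L0 ∪ {v ∈ A | v ∉ templateVerts L0 L ∧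
    ∀ i : Fin k, 4 * ({u ∈ L i | ¬ G.Adj v u}).ncard ≤ G.cliqueNum ^ (s+2)}

/-- `Y_A(𝓛) = (V(𝓛) ∪ N_A(𝓛)) \ Z_A(𝓛)`. -/
def templateYIn {V : Type*} (G : SimpleGraph V) (s : ℕ) (A : Set V) (L0 : Set V) {k : ℕ}
    (L : Fin k → Set V) : Set V :=
  (templateVerts L0 L ∪ templateNbhdIn G A L0 L) \ templateZIn G s A L0 L


namespace DStar
open scoped Classical

variable {V : Type} (G : SimpleGraph V)

/-- Neighbours of `v` inside `Q`. -/
noncomputable def nb (v : V) (Q : Finset V) : Finset V := Q.filter (fun u => G.Adj v u)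
/-- Non-neighbours of `v` inside `Q`. -/
noncomputable def nn (v : V) (Q : Finset V) : Finset V := Q.filter (fun u => ¬ G.Adj v u)

variable {G}

lemma mem_nb {v u : V} {Q : Finset V} : u ∈ nb G v Q ↔ u ∈ Q ∧ G.Adj v u := by simp [nb]
lemma mem_nn {v u : V} {Q : Finset V} : u ∈ nn G v Q ↔ u ∈ Q ∧ ¬ G.Adj v u := by simp [nn]
lemma nb_add_nn (v : V) (Q : Finset V) : (nb G v Q).card + (nn G v Q).card = Q.card := by
  unfold nb nn
  exact Finset.card_filter_add_card_filter_not _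
lemma nb_sub (v : V) (Q : Finset V) : nb G v Q ⊆ Q := Finset.filter_subset _ _
lemma nn_sub (v : V) (Q : Finset V) : nn G v Q ⊆ Q := Finset.filter_subset _ _
lemma nn_mono (v : V) {P Q : Finset V} (h : P ⊆ Q) : nn G v P ⊆ nn G v Q :=
  Finset.filter_subset_filter _ h

/-- Double counting of non-edges. -/
lemma sum_nn_comm (P Q : Finset V) :
    ∑ v ∈ P, (nn G v Q).card = ∑ u ∈ Q, (nn G u P).card := by
  have := Finset.sum_card_bipartiteAbove_eq_sum_card_bipartiteBelow
    (s := P) (t := Q) (fun v u => ¬ G.Adj v u)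
  simp only [Finset.bipartiteAbove, Finset.bipartiteBelow] at this
  unfold nn
  rw [this]
  refine Finset.sum_congr rfl fun u _ => ?_
  congr 1
  ext v
  simp [G.adj_comm]

/-- Averaging. -/
lemma avg_lemma {P Q : Finset V} {a b1 : ℕ} (ha : 0 < a) (hb : 0 < b1)
    (h : ∀ x ∈ P, (nn G x Q).card ≤ a) (hQ : 3 * a ≤ Q.card) (hP : 2 * b1 ≤ P.card) :
    ∃ u ∈ Q, b1 ≤ (nb G u P).card := by
  by_contra hcon
  push Not at hcon
  have h1 : ∑ v ∈ P, (nn G v Q).card ≤ P.card * a := Finset.sum_le_card_nsmul _ _ _ h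
  have h2 : Q.card * (P.card - b1) ≤ ∑ u ∈ Q, (nn G u P).card := by
    apply Finset.card_nsmul_le_sum
    intro u hu
    have := nb_add_nn (G := G) u P
    have := hcon u hu
    omega
  rw [sum_nn_comm] at h1
  have h3 : 3 * a * (P.card - b1) ≤ P.card * a :=
    (Nat.mul_le_mul_right _ hQ).trans (h2.trans h1)
  obtain ⟨t, ht⟩ := Nat.exists_eq_add_of_le hP
  rw [ht] at h3
  have : 2 * b1 + t - b1 = b1 + t := by omega
  rw [this] at h3
  nlinarith

/-- Trimming. -/
lemma trim_lemma {P Q : Finset V} {a b c N : ℕ} (ha : 0 < a)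
    (h : ∀ x ∈ P, (nn G x Q).card ≤ b) (hP : P.card ≤ N) (hN : N * b ≤ a * c) :
    (Q.filter (fun y => a < (nn G y P).card)).card ≤ c := by
  set T := Q.filter (fun y => a < (nn G y P).card) with hT
  have h1 : ∑ v ∈ P, (nn G v Q).card ≤ P.card * b := Finset.sum_le_card_nsmul _ _ _ h
  have h2 : T.card * a ≤ ∑ u ∈ T, (nn G u P).card := by
    apply Finset.card_nsmul_le_sum
    intro u hu
    have := (Finset.mem_filter.1 hu).2
    exact this.le
  have h3 : ∑ u ∈ T, (nn G u P).card ≤ ∑ u ∈ Q, (nn G u P).card :=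
    Finset.sum_le_sum_of_subset (Finset.filter_subset _ _)
  rw [sum_nn_comm] at h1
  have h4 : P.card * b ≤ N * b := Nat.mul_le_mul_right _ hP
  have : a * T.card ≤ a * c := by rw [mul_comm]; omega
  exact Nat.le_of_mul_le_mul_left this ha

/-- Cliques of `A` have at most `w` vertices. -/
def CliqueLe (G : SimpleGraph V) (A : Finset V) (w : ℕ) : Prop :=
  ∀ K : Finset V, K ⊆ A → G.IsClique (K : Set V) → K.card ≤ w

lemma CliqueLe.mono {A B : Finset V} {w : ℕ} (h : CliqueLe G A w) (hB : B ⊆ A) :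
    CliqueLe G B w := fun K hK hc => h K (hK.trans hB) hc

/-- Stable finset. -/
def Stab (G : SimpleGraph V) (S : Finset V) : Prop := ∀ a ∈ S, ∀ b ∈ S, ¬ G.Adj a b

/-- Ramsey. -/
lemma ramsey (w : ℕ) : ∀ (s : ℕ) (X : Finset V), CliqueLe G X w → (w+1)^s ≤ X.card →
    ∃ S ⊆ X, S.card = s ∧ Stab G S := by
  intro s
  induction s with
  | zero => intro X _ _; exact ⟨∅, by simp, by simp, by simp [Stab]⟩
  | succ s ih =>
    intro X hX hc
    -- maximal clique
    obtain ⟨K, hK, hmax⟩ := Finset.exists_max_image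
      (X.powerset.filter (fun K : Finset V => G.IsClique (K : Set V))) Finset.card
      ⟨∅, by simp⟩
    simp only [Finset.mem_filter, Finset.mem_powerset] at hK hmax
    have hKw := hX K hK.1 hK.2
    have hcov : X ⊆ K ∪ K.biUnion (fun k => (nn G k X).erase k) := by
      intro x hx
      by_contra hxx
      simp only [Finset.mem_union, Finset.mem_biUnion, Finset.mem_erase, mem_nn, not_or,
        not_exists, not_and, not_not] at hxx
      have h1 : G.IsClique ((insert x K : Finset V) : Set V) := by
        rw [Finset.coe_insert, SimpleGraph.isClique_insert]
        refine ⟨hK.2, fun b hb hne => ?_⟩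
        exact (hxx.2 b hb hne hx).symm
      have := hmax (insert x K) ⟨Finset.insert_subset hx hK.1, h1⟩
      rw [Finset.card_insert_of_notMem hxx.1] at this
      omega
    by_cases hex : ∃ k ∈ K, (w+1)^s ≤ ((nn G k X).erase k).card
    · obtain ⟨k, hk, hkc⟩ := hex
      have hsub : (nn G k X).erase k ⊆ X := (Finset.erase_subset _ _).trans (nn_sub _ _)
      obtain ⟨S, hS, hSc, hSs⟩ := ih _ (hX.mono hsub) hkc
      have hkS : k ∉ S := fun h => by simpa using hS h
      refine ⟨insert k S, Finset.insert_subset (hK.1 hk) (hS.trans hsub), ?_, ?_⟩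
      · rw [Finset.card_insert_of_notMem hkS, hSc]
      · intro a ha b hb
        have hn : ∀ c ∈ S, ¬ G.Adj k c := fun c hc => by
          have := hS hc
          simp only [Finset.mem_erase, mem_nn] at this
          exact this.2.2
        rcases Finset.mem_insert.1 ha with rfl | ha <;> rcases Finset.mem_insert.1 hb with rfl | hb
        · exact G.loopless.irrefl _
        · exact hn b hb
        · exact fun h => hn _ (by assumption) h.symm
        · exact hSs a ha b hb
    · push Not at hex
      exfalso
      have h1 := Finset.card_le_card hcov
      have h2 := Finset.card_union_le K (K.biUnion (fun k => (nn G k X).erase k))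
      have h3 : (K.biUnion (fun k => (nn G k X).erase k)).card ≤ K.card * ((w+1)^s - 1) := by
        apply Finset.card_biUnion_le_card_mul
        intro k hk
        have := hex k hk
        omega
      have hpos : 0 < (w+1)^s := by positivity
      obtain ⟨t, ht⟩ : ∃ t, (w+1)^s = t + 1 := ⟨(w+1)^s - 1, by omega⟩
      rw [pow_succ] at hc
      rw [ht] at hc h3
      simp only [Nat.add_sub_cancel] at h3
      have : K.card * t ≤ w * t := Nat.mul_le_mul_right _ hKw
      nlinarith

/-- Transversal cliques. -/
lemma transversal {ι : Type} (L : ι → Finset V) (a B : ℕ) (J : Finset ι) :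
    J.card * a ≤ B → (∀ i ∈ J, B < (L i).card) →
    (∀ i ∈ J, ∀ j ∈ J, i ≠ j → ∀ v ∈ L i, (nn G v (L j)).card ≤ a) →
    ∃ K : Finset V, G.IsClique (K : Set V) ∧ K.card = J.card ∧
      ∀ v ∈ K, ∃ i ∈ J, v ∈ L i := by
  induction J using Finset.induction_on with
  | empty =>
    intro _ _ _
    exact ⟨∅, by simp, by simp, by simp⟩
  | insert k J hk ih =>
    intro hJ hB hn
    rw [Finset.card_insert_of_notMem hk] at hJ
    obtain ⟨K, hK, hKc, hKL⟩ := ih (le_trans (by nlinarith) hJ)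
      (fun i hi => hB i (Finset.mem_insert_of_mem hi))
      (fun i hi j hj => hn i (Finset.mem_insert_of_mem hi) j (Finset.mem_insert_of_mem hj))
    have h1 : (K.biUnion (fun v => nn G v (L k))).card ≤ K.card * a := by
      apply Finset.card_biUnion_le_card_mul
      intro v hv
      obtain ⟨i, hi, hvi⟩ := hKL v hv
      exact hn i (Finset.mem_insert_of_mem hi) k (Finset.mem_insert_self _ _)
        (fun h => hk (h ▸ hi)) v hvi
    have h2 := hB k (Finset.mem_insert_self _ _)
    have h3 : (K.biUnion (fun v => nn G v (L k))).card < (L k).card := by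
      rw [hKc] at h1; nlinarith
    obtain ⟨x, hx, hxn⟩ := Finset.exists_mem_notMem_of_card_lt_card h3
    have hadj : ∀ v ∈ K, G.Adj v x := by
      intro v hv
      by_contra h
      exact hxn (Finset.mem_biUnion.2 ⟨v, hv, mem_nn.2 ⟨hx, h⟩⟩)
    have hxK : x ∉ K := fun h => (hadj x h).ne rfl
    refine ⟨insert x K, ?_, ?_, ?_⟩
    · rw [Finset.coe_insert, SimpleGraph.isClique_insert]
      exact ⟨hK, fun b hb _ => (hadj b hb).symm⟩
    · rw [Finset.card_insert_of_notMem hxK, Finset.card_insert_of_notMem hk, hKc]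
    · intro v hv
      rcases Finset.mem_insert.1 hv with rfl | hv
      · exact ⟨k, Finset.mem_insert_self _ _, hx⟩
      · obtain ⟨i, hi, hvi⟩ := hKL v hv
        exact ⟨i, Finset.mem_insert_of_mem hi, hvi⟩

/-- A direct double star contradicts freeness. -/
lemma no_double_star {s : ℕ} (hG : IsInducedFree G (doubleStarGraph s)) {u v : V}
    (huv : G.Adj u v) {S T : Finset V} (hS : S.card = s) (hT : T.card = s)
    (hSs : Stab G S) (hTs : Stab G T) (hST : ∀ x ∈ S, ∀ y ∈ T, ¬ G.Adj x y)
    (hSu : ∀ x ∈ S, G.Adj u x) (hSv : ∀ x ∈ S, ¬ G.Adj v x)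
    (hTv : ∀ x ∈ T, G.Adj v x) (hTu : ∀ x ∈ T, ¬ G.Adj u x) (hvS : v ∉ S) (huT : u ∉ T) : False := by
  let eS := S.equivFinOfCardEq hS
  let eT := T.equivFinOfCardEq hT
  let f : Fin (2*s+2) → V := fun i =>
    if h0 : (i : ℕ) = 0 then u else if h1 : (i : ℕ) = 1 then v else
    if h2 : (i : ℕ) ≤ s + 1 then (eS.symm ⟨i - 2, by omega⟩ : V)
    else (eT.symm ⟨i - (s+2), by omega⟩ : V)
  have hf : ∀ i : Fin (2*s+2), ((i:ℕ) = 0 ∧ f i = u) ∨ ((i:ℕ) = 1 ∧ f i = v) ∨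
      (2 ≤ (i:ℕ) ∧ (i:ℕ) ≤ s+1 ∧ f i ∈ S) ∨ (s + 2 ≤ (i:ℕ) ∧ f i ∈ T) := by
    intro i
    by_cases h0 : (i : ℕ) = 0
    · left; exact ⟨h0, dif_pos h0⟩
    by_cases h1 : (i : ℕ) = 1
    · right; left; refine ⟨h1, ?_⟩; simp only [f]; rw [dif_neg h0, dif_pos h1]
    by_cases h2 : (i : ℕ) ≤ s + 1
    · right; right; left
      refine ⟨by omega, h2, ?_⟩
      simp only [f, h0, h1, h2, dif_neg, dif_pos, not_false_eq_true]
      exact Subtype.coe_prop _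
    · right; right; right
      refine ⟨by omega, ?_⟩
      simp only [f, h0, h1, h2, dif_neg, not_false_eq_true]
      exact Subtype.coe_prop _
  have hinjS : ∀ i j : Fin (2*s+2), 2 ≤ (i:ℕ) → (i:ℕ) ≤ s+1 → 2 ≤ (j:ℕ) → (j:ℕ) ≤ s+1 →
      f i = f j → i = j := by
    intro i j hi hi' hj hj' h
    simp only [f, hi', hj', dif_pos, show ¬ (i:ℕ) = 0 by omega, show ¬ (i:ℕ) = 1 by omega,
      show ¬ (j:ℕ) = 0 by omega, show ¬ (j:ℕ) = 1 by omega, dif_neg, not_false_eq_true] at h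
    have := eS.symm.injective (Subtype.ext h)
    simp only [Fin.mk.injEq] at this
    ext; omega
  have hinjT : ∀ i j : Fin (2*s+2), s + 2 ≤ (i:ℕ) → s+2 ≤ (j:ℕ) → f i = f j → i = j := by
    intro i j hi hj h
    simp only [f, show ¬ (i:ℕ) ≤ s+1 by omega, show ¬ (j:ℕ) ≤ s+1 by omega,
      show ¬ (i:ℕ) = 0 by omega, show ¬ (i:ℕ) = 1 by omega,
      show ¬ (j:ℕ) = 0 by omega, show ¬ (j:ℕ) = 1 by omega, dif_neg, not_false_eq_true] at h
    have := eT.symm.injective (Subtype.ext h)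
    simp only [Fin.mk.injEq] at this
    ext; omega
  have huS : u ∉ S := fun h => (hSu u h).ne rfl
  have hvT : v ∉ T := fun h => (hTv v h).ne rfl
  have hne : u ≠ v := huv.ne
  have hdis : ∀ x ∈ S, x ∉ T := fun x hx hx' => hTu x hx' (hSu x hx)
  have hinj : Function.Injective f := by
    intro i j h
    rcases hf i with hi | hi | hi | hi <;> rcases hf j with hj | hj | hj | hj
    · ext; omega
    · rw [hi.2, hj.2] at h; exact (hne h).elim
    · rw [hi.2] at h; rw [← h] at hj; exact (huS hj.2.2).elim
    · rw [hi.2] at h; rw [← h] at hj; exact (huT hj.2).elim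
    · rw [hi.2, hj.2] at h; exact (hne h.symm).elim
    · ext; omega
    · rw [hi.2] at h; rw [← h] at hj; exact (hvS hj.2.2).elim
    · rw [hi.2] at h; rw [← h] at hj; exact (hvT hj.2).elim
    · rw [hj.2] at h; rw [h] at hi; exact (huS hi.2.2).elim
    · rw [hj.2] at h; rw [h] at hi; exact (hvS hi.2.2).elim
    · exact hinjS i j hi.1 hi.2.1 hj.1 hj.2.1 h
    · rw [h] at hi; exact (hdis _ hi.2.2 hj.2).elim
    · rw [hj.2] at h; rw [h] at hi; exact (huT hi.2).elim
    · rw [hj.2] at h; rw [h] at hi; exact (hvT hi.2).elim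
    · rw [h] at hi; exact (hdis _ hj.2.2 hi.2).elim
    · exact hinjT i j hi.1 hj.1 h
  have hadj : ∀ i j, G.Adj (f i) (f j) ↔ (doubleStarGraph s).Adj i j := by
    intro i j
    have hij : i ≠ j ↔ (i:ℕ) ≠ j := by simp [Fin.ext_iff]
    simp only [doubleStarGraph, SimpleGraph.fromRel_adj, hij]
    rcases hf i with hi | hi | hi | hi <;> rcases hf j with hj | hj | hj | hj
    · rw [hi.2, hj.2]; exact iff_of_false (G.loopless.irrefl _) (by omega)
    · rw [hi.2, hj.2]; exact iff_of_true huv (by omega)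
    · rw [hi.2]; exact iff_of_true (hSu _ hj.2.2) (by omega)
    · rw [hi.2]; exact iff_of_false (hTu _ hj.2) (by omega)
    · rw [hi.2, hj.2]; exact iff_of_true huv.symm (by omega)
    · rw [hi.2, hj.2]; exact iff_of_false (G.loopless.irrefl _) (by omega)
    · rw [hi.2]; exact iff_of_false (hSv _ hj.2.2) (by omega)
    · rw [hi.2]; exact iff_of_true (hTv _ hj.2) (by omega)
    · rw [hj.2]; exact iff_of_true (hSu _ hi.2.2).symm (by omega)
    · rw [hj.2]; exact iff_of_false (fun h => hSv _ hi.2.2 h.symm) (by omega)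
    · exact iff_of_false (hSs _ hi.2.2 _ hj.2.2) (by omega)
    · exact iff_of_false (hST _ hi.2.2 _ hj.2) (by omega)
    · rw [hj.2]; exact iff_of_false (fun h => hTu _ hi.2 h.symm) (by omega)
    · rw [hj.2]; exact iff_of_true (hTv _ hi.2).symm (by omega)
    · exact iff_of_false (fun h => hST _ hj.2.2 _ hi.2 h.symm) (by omega)
    · exact iff_of_false (hTs _ hi.2 _ hj.2) (by omega)
  apply hG (Set.range f)
  refine ⟨RelIso.symm ⟨Equiv.ofInjective f hinj, ?_⟩⟩
  intro i j
  exact hadj i j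

/-- First crowding lemma. -/
lemma crowd {s W : ℕ} (hG : IsInducedFree G (doubleStarGraph s)) {u v : V}
    (huv : G.Adj u v) {S P : Finset V} (hP : CliqueLe G P W) (hS : S.card = s)
    (hSs : Stab G S) (hST : ∀ x ∈ S, ∀ y ∈ P, ¬ G.Adj x y)
    (hSu : ∀ x ∈ S, G.Adj u x) (hSv : ∀ x ∈ S, ¬ G.Adj v x)
    (hTv : ∀ x ∈ P, G.Adj v x) (hTu : ∀ x ∈ P, ¬ G.Adj u x) (hvS : v ∉ S) (huT : u ∉ P) :
    P.card < (W+1)^s := by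
  by_contra hcon
  push Not at hcon
  obtain ⟨T, hT, hTc, hTs⟩ := ramsey W s P hP hcon
  exact no_double_star hG huv hS hTc hSs hTs (fun x hx y hy => hST x hx y (hT hy)) hSu hSv
    (fun x hx => hTv x (hT hx)) (fun x hx => hTu x (hT hx)) hvS (fun h => huT (hT h))

/-- Second crowding lemma. -/
lemma crowd2 {s W : ℕ} (hG : IsInducedFree G (doubleStarGraph s)) {u v : V}
    (huv : G.Adj u v) {Q P : Finset V} (hP : CliqueLe G P W) (hQ : CliqueLe G Q W)
    (hQc : (W+1)^s ≤ Q.card) (hST : ∀ x ∈ Q, ∀ y ∈ P, ¬ G.Adj x y)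
    (hSu : ∀ x ∈ Q, G.Adj u x) (hSv : ∀ x ∈ Q, ¬ G.Adj v x)
    (hTv : ∀ x ∈ P, G.Adj v x) (hTu : ∀ x ∈ P, ¬ G.Adj u x) (hvS : v ∉ Q) (huT : u ∉ P) :
    P.card < (W+1)^s := by
  obtain ⟨S, hS, hSc, hSs⟩ := ramsey W s Q hQ hQc
  exact crowd hG huv hP hSc hSs (fun x hx => hST x (hS hx)) (fun x hx => hSu x (hS hx))
    (fun x hx => hSv x (hS hx)) hTv hTu (fun h => hvS (hS h)) huT
end DStar


namespace DStar
open scoped Classical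

/-- The numerical constants used, with the inequalities between them. -/
structure Cst (s W : ℕ) where
  /-- Ramsey bound -/
  q : ℕ
  /-- half of b -/
  b1 : ℕ
  /-- fullness threshold -/
  b : ℕ
  /-- template density -/
  a : ℕ
  /-- trimming loss -/
  c : ℕ
  /-- lower size of parts -/
  U : ℕ
  /-- weight of `L0` -/
  lam : ℕ
  /-- upper size of parts -/
  N : ℕ
  /-- slack -/
  z : ℕ
  hW : 1 ≤ W
  hq : q = (W+1)^s
  hqb : q ≤ b1
  hb : b = 2 * b1
  hba : b ≤ a
  hNb : N * b ≤ a * c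
  hloss : a + W * b + W * c ≤ U
  hWa : (W + 1) * a < U
  h10 : 10 * a ≤ U
  hac : a + c < U
  hNq : N * q ≤ b1 * U
  hz : z = lam * W + 5 * W * U
  hlam : lam = 10 * U * W
  hzN : (W + 1) * z ≤ N

namespace Cst
variable {s W : ℕ} (k : Cst s W)
lemma q_pos : 0 < k.q := by rw [k.hq]; positivity
lemma b1_pos : 0 < k.b1 := lt_of_lt_of_le k.q_pos k.hqb
lemma b_pos : 0 < k.b := by rw [k.hb]; have := k.b1_pos; omega
lemma a_pos : 0 < k.a := lt_of_lt_of_le k.b_pos k.hba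
lemma U_pos : 0 < k.U := by have := k.h10; have := k.a_pos; omega
lemma Wb_lt : W * k.b < k.U := by
  have := k.hWa
  have := Nat.mul_le_mul_left W k.hba
  have := k.a_pos
  nlinarith
lemma UN : 15 * k.U ≤ k.N := by
  have h1 := k.hzN
  rw [k.hz, k.hlam] at h1
  have h2 := k.hW
  obtain ⟨w, rfl⟩ := Nat.exists_eq_add_of_le h2
  nlinarith [Nat.zero_le (k.U * w), Nat.zero_le (k.U * w * w), Nat.zero_le (k.U * w * w * w)]
end Cst

variable {V : Type} {G : SimpleGraph V} {s W : ℕ}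

/-- Pretemplates. -/
structure PreT (k : Cst s W) (G : SimpleGraph V) (A : Finset V) {ι : Type} [Fintype ι]
    (L0 : Finset V) (L : ι → Finset V) : Prop where
  sub0 : L0 ⊆ A
  sub : ∀ i, L i ⊆ A
  clique : G.IsClique (L0 : Set V)
  compl : ∀ x ∈ L0, ∀ i, ∀ y ∈ L i, G.Adj x y
  disj : ∀ i j, i ≠ j → Disjoint (L i) (L j)
  le : ∀ i, (L i).card ≤ k.N
  dense : ∀ i j, i ≠ j → ∀ v ∈ L i, (nn G v (L j)).card ≤ k.a

/-- Templates. -/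
structure Templ (k : Cst s W) (G : SimpleGraph V) (A : Finset V) {ι : Type} [Fintype ι]
    (L0 : Finset V) (L : ι → Finset V) : Prop extends PreT k G A L0 L where
  big : ∀ i, k.U ≤ (L i).card

/-- The value of a template. -/
def val (k : Cst s W) {ι : Type} [Fintype ι] (L0 : Finset V) (L : ι → Finset V) : ℕ :=
  k.lam * L0.card + ∑ i, ((L i).card + k.U)

/-- `X` bounds all template values in `A`. -/
def MaxVal (k : Cst s W) (G : SimpleGraph V) (A : Finset V) (X : ℕ) : Prop :=
  ∀ (ι : Type) [Fintype ι] (L0 : Finset V) (L : ι → Finset V), Templ k G A L0 L → val k L0 L ≤ X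

lemma val_eq (k : Cst s W) {ι : Type} [Fintype ι] (L0 : Finset V) (L : ι → Finset V) :
    val k L0 L = k.lam * L0.card + ∑ i, (L i).card + k.U * Fintype.card ι := by
  simp [val, Finset.sum_add_distrib, mul_comm, add_assoc]

variable {k : Cst s W} {A : Finset V} {ι : Type} [Fintype ι] {L0 : Finset V} {L : ι → Finset V}

lemma PreT.card0 (h : PreT k G A L0 L) (hA : CliqueLe G A W) : L0.card ≤ W :=
  hA L0 h.sub0 h.clique

lemma Templ.cardι (h : Templ k G A L0 L) (hA : CliqueLe G A W) : Fintype.card ι ≤ W := by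
  by_contra hcon
  push Not at hcon
  obtain ⟨J, hJ⟩ := Finset.exists_subset_card_eq (s := (Finset.univ : Finset ι)) (n := W+1)
    (by rw [Finset.card_univ]; exact hcon)
  obtain ⟨K, hK, hKc, hKL⟩ := transversal (G := G) L k.a ((W+1)*k.a) J (by rw [hJ.2])
    (fun i _ => lt_of_lt_of_le k.hWa (h.big i)) (fun i _ j _ hij => h.dense i j hij)
  have := hA K (fun v hv => by obtain ⟨i, -, hi⟩ := hKL v hv; exact h.sub i hi) hK
  omega

lemma PreT.drop (h : PreT k G A L0 L) {X : ℕ} (hX : MaxVal k G A X) :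
    k.lam * L0.card + ∑ i, (L i).card ≤ X + k.U * Fintype.card ι := by
  have hT : Templ k G A L0 (fun i : {i // k.U ≤ (L i).card} => L i.1) :=
    { sub0 := h.sub0
      sub := fun i => h.sub i.1
      clique := h.clique
      compl := fun x hx i => h.compl x hx i.1
      disj := fun i j hij => h.disj _ _ (fun e => hij (Subtype.ext e))
      le := fun i => h.le i.1
      dense := fun i j hij => h.dense _ _ (fun e => hij (Subtype.ext e))
      big := fun i => i.2 }
  have h1 := hX _ _ _ hT
  unfold val at h1
  have h2 : ∑ i, (L i).card ≤
      ∑ i : {i // k.U ≤ (L i).card}, ((L i.1).card + k.U) + k.U * Fintype.card ι := by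
    rw [← Finset.sum_subtype (Finset.univ.filter (fun i => k.U ≤ (L i).card)) (by simp)
      (fun i => (L i).card + k.U), Finset.sum_filter]
    have e : k.U * Fintype.card ι = ∑ _i : ι, k.U := by simp [mul_comm]
    rw [e, ← Finset.sum_add_distrib]
    refine Finset.sum_le_sum fun i _ => ?_
    split_ifs <;> omega
  simp only at h1
  omega

lemma card_le_add_of_cover {α : Type} {X Y Z : Finset α} (h : X ⊆ Y ∪ Z) :
    X.card ≤ Y.card + Z.card := (Finset.card_le_card h).trans (Finset.card_union_le _ _)

/-- Combine lemma. -/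
lemma combine (h : Templ k G A L0 L) (hA : CliqueLe G A W) (hX : MaxVal k G A (val k L0 L))
    (J : Finset ι) (L' : ι → Finset V) (hL' : ∀ i, L' i ⊆ L i)
    (hLc : ∀ i ∈ J, (L i).card ≤ (L' i).card + k.a) {M : Finset V} (hM : M ⊆ A)
    (hMd : ∀ i, Disjoint M (L i))
    (hMb : ∀ v ∈ M, ∀ i ∈ J, (nn G v (L' i)).card ≤ k.b) :
    MaxVal k G M (k.z + ∑ i ∈ Jᶜ, ((L i).card + k.U)) := by
  intro ι2 _ P0 P hP
  have hMA : CliqueLe G M W := hA.mono hM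
  have hc2 := hP.cardι hMA
  have h02 := hP.card0 hMA
  have h00 := h.card0 hA
  have hc1 := h.cardι hA
  let L2 : ι → Finset V := fun i => (L' i).filter (fun y =>
    (∀ x ∈ P0, G.Adj x y) ∧ ∀ j, (nn G y (P j)).card ≤ k.a)
  have hL2 : ∀ i, L2 i ⊆ L i := fun i => (Finset.filter_subset _ _).trans (hL' i)
  have hL2c : ∀ i ∈ J, (L i).card ≤ (L2 i).card + k.U := by
    intro i hi
    have e1 : L' i ⊆ L2 i ∪ (P0.biUnion (fun x => nn G x (L' i)) ∪
        Finset.univ.biUnion (fun j => (L' i).filter (fun y => k.a < (nn G y (P j)).card))) := by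
      intro y hy
      by_contra hcon
      simp only [L2, Finset.mem_union, Finset.mem_biUnion, Finset.mem_filter, hy, true_and,
        mem_nn, Finset.mem_univ, not_or, not_and, not_exists, not_lt, not_not] at hcon
      obtain ⟨j, hj⟩ := not_forall.1 (hcon.1 (fun x hx => hcon.2.1 x hx))
      exact hj (hcon.2.2 j)
    have e2 := card_le_add_of_cover e1
    have e3 := Finset.card_union_le (P0.biUnion (fun x => nn G x (L' i)))
      (Finset.univ.biUnion (fun j => (L' i).filter (fun y => k.a < (nn G y (P j)).card)))
    have e4 : (P0.biUnion (fun x => nn G x (L' i))).card ≤ P0.card * k.b :=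
      Finset.card_biUnion_le_card_mul _ _ _ (fun x hx => hMb x (hP.sub0 hx) i hi)
    have e5 : (Finset.univ.biUnion (fun j => (L' i).filter
        (fun y => k.a < (nn G y (P j)).card))).card ≤ (Finset.univ : Finset ι2).card * k.c :=
      Finset.card_biUnion_le_card_mul _ _ _ (fun j _ => trim_lemma k.a_pos
        (fun x hx => hMb x (hP.sub j hx) i hi) (hP.le j) k.hNb)
    rw [Finset.card_univ] at e5
    have e6 := Nat.mul_le_mul_right k.b h02
    have e7 := Nat.mul_le_mul_right k.c hc2
    have e8 := k.hloss
    have e9 := hLc i hi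
    omega
  have hpre : PreT k G A P0 (fun t : {i // i ∈ J} ⊕ ι2 => Sum.elim (fun i => L2 i.1) P t) :=
    { sub0 := hP.sub0.trans hM
      sub := by
        rintro (i | j)
        · exact (hL2 i.1).trans (h.sub _)
        · exact (hP.sub j).trans hM
      clique := hP.clique
      compl := by
        rintro x hx (i | j) y hy
        · exact (Finset.mem_filter.1 hy).2.1 x hx
        · exact hP.compl x hx j y hy
      disj := by
        rintro (i | j) (i' | j') hne
        · exact (h.disj i.1 i'.1 (fun e => hne (by rw [Subtype.ext e]))).mono (hL2 _) (hL2 _)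
        · exact ((hMd i.1).symm).mono (hL2 _) (hP.sub _)
        · exact (hMd i'.1).mono (hP.sub _) (hL2 _)
        · exact hP.disj _ _ (fun e => hne (by rw [e]))
      le := by
        rintro (i | j)
        · exact (Finset.card_le_card (hL2 _)).trans (h.le _)
        · exact hP.le j
      dense := by
        rintro (i | j) (i' | j') hne v hv
        · exact (Finset.card_le_card (nn_mono v (hL2 _))).trans
            (h.dense i.1 i'.1 (fun e => hne (by rw [Subtype.ext e])) v (hL2 _ hv))
        · exact (Finset.mem_filter.1 hv).2.2 j'
        · exact ((Finset.card_le_card (nn_mono v (Finset.filter_subset _ _))).trans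
            (hMb v (hP.sub _ hv) i'.1 i'.2)).trans k.hba
        · exact hP.dense _ _ (fun e => hne (by rw [e])) v hv }
  have hd := hpre.drop hX
  rw [val_eq] at hd ⊢
  rw [Fintype.sum_sum_type, Fintype.card_sum, Fintype.card_coe] at hd
  simp only [Sum.elim_inl, Sum.elim_inr] at hd
  rw [Finset.sum_coe_sort J (fun i => (L2 i).card)] at hd
  have f1 : ∑ i ∈ J, (L i).card ≤ ∑ i ∈ J, (L2 i).card + J.card * k.U := by
    rw [← smul_eq_mul, ← Finset.sum_const, ← Finset.sum_add_distrib]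
    exact Finset.sum_le_sum hL2c
  have f2 := Finset.sum_add_sum_compl J (fun i => (L i).card)
  have f3 : Fintype.card ι = J.card + Jᶜ.card := (Finset.card_add_card_compl J).symm
  rw [Finset.sum_add_distrib, Finset.sum_const, smul_eq_mul]
  have hJ : J.card ≤ W := (Finset.card_le_univ J).trans hc1
  rw [f3] at hd
  rw [k.hz]
  have g1 := Nat.mul_le_mul_right k.U hJ
  have g2 := Nat.mul_le_mul_right k.U hc2
  have g3 := Nat.mul_le_mul_left k.lam h00
  nlinarith
end DStar


namespace DStar
open scoped Classical
variable {V : Type} {G : SimpleGraph V} {s W : ℕ}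
variable {k : Cst s W} {A : Finset V} {ι : Type} [Fintype ι] {L0 : Finset V} {L : ι → Finset V}

lemma single_templ {M : Finset V} {T : Finset V} (hT : T ⊆ M) (h1 : k.U ≤ T.card)
    (h2 : T.card ≤ k.N) : Templ k G M ∅ (fun _ : Unit => T) :=
  { sub0 := by simp
    sub := fun _ => hT
    clique := by simp
    compl := by simp
    disj := fun i j h => (h rfl).elim
    le := fun _ => h2
    dense := fun i j h => (h rfl).elim
    big := fun _ => h1 }

lemma maxVal_ge {M : Finset V} {X : ℕ} (hX : MaxVal k G M X) (hM : k.N ≤ M.card) :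
    k.N + k.U ≤ X := by
  obtain ⟨T, hT, hTc⟩ := Finset.exists_subset_card_eq hM
  have := hX _ _ _ (single_templ (k := k) (G := G) hT (by have := k.UN; omega) hTc.le)
  simpa [val, hTc] using this

/-- Sets full to everything are small. -/
lemma combine_small (h : Templ k G A L0 L) (hA : CliqueLe G A W)
    (hX : MaxVal k G A (val k L0 L))
    (L' : ι → Finset V) (hL' : ∀ i, L' i ⊆ L i)
    (hLc : ∀ i, (L i).card ≤ (L' i).card + k.a) {M : Finset V} (hM : M ⊆ A)
    (hMd : ∀ i, Disjoint M (L i))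
    (hMb : ∀ v ∈ M, ∀ i, (nn G v (L' i)).card ≤ k.b) : M.card < k.N := by
  by_contra hcon
  push Not at hcon
  have := maxVal_ge (combine h hA hX Finset.univ L' hL' (fun i _ => hLc i) hM hMd
    (fun v hv i _ => hMb v hv i)) hcon
  simp at this
  have h2 := k.hzN
  have := k.U_pos
  nlinarith

/-- Lemma A. -/
lemma lemmaA (h : Templ k G A L0 L) (hA : CliqueLe G A W) (hX : MaxVal k G A (val k L0 L))
    {i : ι} {x : V} (hx : x ∈ L i) : 4 * k.U < (nn G x (L i)).card := by
  by_contra hcon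
  push Not at hcon
  have hx0 : x ∉ L0 := fun hh => (h.compl x hh i x hx).ne rfl
  have hpre : PreT k G A (insert x L0) (fun j => nb G x (L j)) :=
    { sub0 := Finset.insert_subset (h.sub i hx) h.sub0
      sub := fun j => (nb_sub _ _).trans (h.sub j)
      clique := by
        rw [Finset.coe_insert, SimpleGraph.isClique_insert]
        exact ⟨h.clique, fun b hb _ => (h.compl b hb i x hx).symm⟩
      compl := by
        intro y hy j v hv
        rw [mem_nb] at hv
        rcases Finset.mem_insert.1 hy with rfl | hy
        · exact hv.2
        · exact h.compl y hy j v hv.1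
      disj := fun j j' hj => (h.disj j j' hj).mono (nb_sub _ _) (nb_sub _ _)
      le := fun j => (Finset.card_le_card (nb_sub _ _)).trans (h.le j)
      dense := fun j j' hj v hv => (Finset.card_le_card (nn_mono v (nb_sub _ _))).trans
        (h.dense j j' hj v (nb_sub _ _ hv)) }
  have hd := hpre.drop hX
  rw [val_eq, Finset.card_insert_of_notMem hx0] at hd
  have e : ∑ j, (L j).card ≤ ∑ j, (nb G x (L j)).card + Fintype.card ι * (4 * k.U) := by
    rw [← Finset.card_univ, ← smul_eq_mul, ← Finset.sum_const, ← Finset.sum_add_distrib]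
    refine Finset.sum_le_sum fun j _ => ?_
    have e1 := nb_add_nn (G := G) x (L j)
    by_cases hj : i = j
    · subst hj; omega
    · have := h.dense i j hj x hx
      have := k.h10
      omega
  have hc := Nat.mul_le_mul_right k.U (h.cardι hA)
  have hl := k.hlam
  have hWU : 0 < k.U * W := Nat.mul_pos k.U_pos k.hW
  nlinarith

/-- Prime lemma. -/
lemma prime (h : Templ k G A L0 L) (hA : CliqueLe G A W) (hX : MaxVal k G A (val k L0 L))
    {i : ι} {X Y : Finset V} (hXL : X ⊆ L i) (hYL : Y ⊆ L i) (hXY : Disjoint X Y)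
    (hcov : (L i).card ≤ X.card + Y.card + k.a) (hne : X.Nonempty)
    (hq : ∀ x ∈ X, (nn G x Y).card < k.q) : Y.card < k.b1 := by
  by_contra hcon
  push Not at hcon
  have hXY' : ∀ x, (nn G x (L i)).card ≤ (nn G x X).card + (nn G x Y).card + k.a := by
    intro x
    have e1 : nn G x (L i) ⊆ nn G x (X ∪ Y) ∪ (L i \ (X ∪ Y)) := by
      intro y hy
      rw [mem_nn] at hy
      simp only [Finset.mem_union, mem_nn, Finset.mem_sdiff]
      tauto
    have e2 := card_le_add_of_cover e1
    have e3 : nn G x (X ∪ Y) ⊆ nn G x X ∪ nn G x Y := by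
      intro y hy
      simp only [Finset.mem_union, mem_nn] at hy ⊢
      tauto
    have e4 := card_le_add_of_cover e3
    have e5 : (L i \ (X ∪ Y)).card ≤ k.a := by
      rw [Finset.card_sdiff_of_subset (Finset.union_subset hXL hYL),
        Finset.card_union_of_disjoint hXY]
      omega
    omega
  have hnn : ∀ x (T : Finset V), (nn G x T).card ≤ T.card := fun x T =>
    Finset.card_le_card (nn_sub _ _)
  have h10 := k.h10
  have hqa : k.q ≤ k.a := by have := k.hqb; have := k.hb; have := k.hba; omega
  have hXU : 2 * k.U ≤ X.card := by
    obtain ⟨x, hx⟩ := hne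
    have e1 := lemmaA h hA hX (hXL hx)
    have e2 := hXY' x
    have e3 := hq x hx
    have e4 := hnn x X
    omega
  have hXN : X.card ≤ k.N := (Finset.card_le_card hXL).trans (h.le i)
  have hYN : Y.card ≤ k.N := (Finset.card_le_card hYL).trans (h.le i)
  -- averaging
  have hYU : 2 * k.U ≤ Y.card := by
    have hy : ∃ y ∈ Y, (nn G y X).card ≤ k.U := by
      by_contra hno
      push Not at hno
      have e1 : Y.card * (k.U + 1) ≤ ∑ y ∈ Y, (nn G y X).card := by
        rw [← smul_eq_mul]
        exact Finset.card_nsmul_le_sum _ _ _ (fun y hy => hno y hy)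
      rw [sum_nn_comm] at e1
      have e2 : ∑ x ∈ X, (nn G x Y).card ≤ X.card * k.q :=
        Finset.sum_le_card_nsmul _ _ _ (fun x hx => (hq x hx).le)
      have e3 := Nat.mul_le_mul_right k.q hXN
      have e4 := k.hNq
      have e5 := Nat.mul_le_mul_right k.U hcon
      have := k.b1_pos
      nlinarith
    obtain ⟨y, hy, hyX⟩ := hy
    have e1 := lemmaA h hA hX (hYL hy)
    have e2 := hXY' y
    have e4 := hnn y Y
    omega
  let Y' := Y.filter (fun y => (nn G y X).card ≤ k.a)
  have hY'Y : Y' ⊆ Y := Finset.filter_subset _ _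
  have hba := k.hba
  have hYc : Y.card ≤ Y'.card + k.c := by
    have e1 : Y ⊆ Y' ∪ Y.filter (fun y => k.a < (nn G y X).card) := by
      intro y hy
      simp only [Y', Finset.mem_union, Finset.mem_filter, hy, true_and]
      omega
    have e2 := card_le_add_of_cover e1
    have e3 := trim_lemma (G := G) (P := X) (Q := Y) (b := k.b) (c := k.c) k.a_pos
      (fun x hx => by have := hq x hx; have := k.hqb; have := k.hb; omega) hXN k.hNb
    omega
  have hac := k.hac
  let T : Option ι → Finset V := fun o => o.elim Y' (fun j => if j = i then X else L j)
  have hTs : ∀ j, T (some j) ⊆ L j := by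
    intro j
    by_cases hj : j = i
    · subst hj; simpa [T] using hXL
    · simp [T, hj]
  have hT0 : T none = Y' := rfl
  have hTi : T (some i) = X := by simp [T]
  have hY'L : Y' ⊆ L i := hY'Y.trans hYL
  have hd0 : ∀ j, Disjoint (T none) (T (some j)) := by
    intro j
    by_cases hj : j = i
    · subst hj; rw [hTi]; exact hXY.symm.mono hY'Y le_rfl
    · exact (h.disj i j (Ne.symm hj)).mono hY'L (hTs j)
  have htempl : Templ k G A L0 T :=
    { sub0 := h.sub0
      sub := by
        rintro (_ | j)
        · exact hY'L.trans (h.sub i)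
        · exact (hTs j).trans (h.sub j)
      clique := h.clique
      compl := by
        rintro x hx (_ | j) y hy
        · exact h.compl x hx i y (hY'L hy)
        · exact h.compl x hx j y (hTs j hy)
      disj := by
        rintro (_ | j) (_ | j') hne
        · exact (hne rfl).elim
        · exact hd0 _
        · exact (hd0 _).symm
        · exact (h.disj j j' (fun e => hne (by rw [e]))).mono (hTs _) (hTs _)
      le := by
        rintro (_ | j)
        · exact (Finset.card_le_card hY'L).trans (h.le i)
        · exact (Finset.card_le_card (hTs j)).trans (h.le j)
      dense := by
        rintro (_ | j) (_ | j') hne v hv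
        · exact (hne rfl).elim
        · by_cases hj : j' = i
          · subst hj; rw [hTi]; exact (Finset.mem_filter.1 hv).2
          · exact (Finset.card_le_card (nn_mono v (hTs j'))).trans
              (h.dense i j' (Ne.symm hj) v (hY'L hv))
        · by_cases hj : j = i
          · subst hj; rw [hTi] at hv
            exact ((Finset.card_le_card (nn_mono v hY'Y)).trans (hq v hv).le).trans hqa
          · exact (Finset.card_le_card (nn_mono v hY'L)).trans
              (h.dense j i hj v (hTs j hv))
        · exact (Finset.card_le_card (nn_mono v (hTs _))).trans
            (h.dense j j' (fun e => hne (by rw [e])) v (hTs _ hv))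
      big := by
        rintro (_ | j)
        · rw [hT0]; omega
        · by_cases hj : j = i
          · subst hj; rw [hTi]; omega
          · simpa [T, hj] using h.big j }
  have hv := hX _ _ _ htempl
  rw [val_eq, val_eq, Fintype.sum_option, Fintype.card_option, hT0] at hv
  have f1 := Finset.add_sum_erase Finset.univ (fun j => (L j).card) (Finset.mem_univ i)
  have f2 := Finset.add_sum_erase Finset.univ (fun j => (T (some j)).card) (Finset.mem_univ i)
  have f3 : ∑ j ∈ Finset.univ.erase i, (T (some j)).card =
      ∑ j ∈ Finset.univ.erase i, (L j).card := by
    refine Finset.sum_congr rfl fun j hj => ?_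
    have := Finset.ne_of_mem_erase hj
    simp [T, this]
  simp only [hTi] at f2
  rw [f3] at f2
  have f4 : k.U * (Fintype.card ι + 1) = k.U * Fintype.card ι + k.U := by ring
  rw [f4] at hv
  omega
end DStar


namespace DStar
open scoped Classical
variable {V : Type} {G : SimpleGraph V} {s W : ℕ}
variable {k : Cst s W} {A : Finset V} {ι : Type} [Fintype ι] {L0 : Finset V} {L : ι → Finset V}

/-- private neighbourhood size threshold -/
def Cst.p (k : Cst s W) : ℕ := k.N ^ s * k.q + k.N
/-- degree threshold -/
def Cst.d0 (k : Cst s W) : ℕ := W * k.p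

/-- Bound on all values. -/
def Cst.X0 (k : Cst s W) : ℕ := W * (k.N + k.U + k.lam)

lemma Templ.val_le (h : Templ k G A L0 L) (hA : CliqueLe G A W) : val k L0 L ≤ k.X0 := by
  have h1 := h.card0 hA
  have h2 := h.cardι hA
  have h3 : ∑ i, ((L i).card + k.U) ≤ Fintype.card ι * (k.N + k.U) := by
    rw [← Finset.card_univ, ← smul_eq_mul]
    exact Finset.sum_le_card_nsmul _ _ _ (fun i _ => Nat.add_le_add_right (h.le i) _)
  have h4 := Nat.mul_le_mul_right (k.N + k.U) h2
  have h5 := Nat.mul_le_mul_left k.lam h1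
  unfold val Cst.X0
  nlinarith

lemma maxVal_X0 (hA : CliqueLe G A W) : MaxVal k G A k.X0 := fun _ _ _ _ h => h.val_le hA

lemma kst_edge (hA : CliqueLe G A W) (hne : A.Nonempty)
    (hdeg : ∀ v ∈ A, k.d0 < (nb G v A).card) :
    ∃ u ∈ A, ∃ v ∈ A, G.Adj u v ∧ k.p ≤ ((nn G u (nb G v A)).erase u).card ∧
      k.p ≤ ((nn G v (nb G u A)).erase v).card := by
  by_contra hcon
  push Not at hcon
  obtain ⟨v, hv, hmin⟩ := Finset.exists_min_image A (fun v => (nb G v A).card) hne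
  have hU := k.U_pos
  have key : ∀ w ∈ nb G v A, (nn G w (nb G v A)).card ≤ k.p := by
    intro w hw
    rw [mem_nb] at hw
    have hd := hmin w hw.1
    have e1 := nb_add_nn (G := G) w (nb G v A)
    have e2 := nb_add_nn (G := G) v (nb G w A)
    have e3 : nb G w (nb G v A) = nb G v (nb G w A) := by
      ext x; simp only [mem_nb]; tauto
    have m1 : w ∈ nn G w (nb G v A) := by simp [mem_nn, mem_nb, hw]
    have m2 : v ∈ nn G v (nb G w A) := by simp [mem_nn, mem_nb, hv, hw.2.symm]
    have c1 := Finset.card_erase_add_one m1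
    have c2 := Finset.card_erase_add_one m2
    rw [e3] at e1
    by_contra hlt
    push Not at hlt
    have := hcon w hw.1 v hv hw.2.symm (by omega)
    omega
  have hdv := hdeg v hv
  obtain ⟨K, hK, hKc, hKL⟩ := transversal (G := G) (fun _ : Fin W => nb G v A) k.p k.d0
    Finset.univ (by simp [Cst.d0]) (fun i _ => hdv) (fun i _ j _ _ w hw => key w hw)
  have hKs : ∀ x ∈ K, x ∈ A ∧ G.Adj v x := fun x hx => by
    obtain ⟨i, -, hi⟩ := hKL x hx; exact mem_nb.1 hi
  have hvK : v ∉ K := fun hh => (hKs v hh).2.ne rfl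
  have := hA (insert v K) (Finset.insert_subset hv (fun x hx => (hKs x hx).1)) (by
    rw [Finset.coe_insert, SimpleGraph.isClique_insert]
    exact ⟨hK, fun b hb _ => (hKs b hb).2⟩)
  rw [Finset.card_insert_of_notMem hvK, hKc] at this
  simp at this

lemma kst_templ (hG : IsInducedFree G (doubleStarGraph s)) (hA : CliqueLe G A W)
    (hne : A.Nonempty) (hdeg : ∀ v ∈ A, k.d0 < (nb G v A).card) :
    ∃ L : Bool → Finset V, Templ k G A ∅ L ∧ k.lam * W + k.N + k.U < val k ∅ L := by
  obtain ⟨u, hu, v, hv, huv, hpv, hpu⟩ := kst_edge hA hne hdeg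
  set Pv := (nn G u (nb G v A)).erase u with hPv
  set Pu := (nn G v (nb G u A)).erase v with hPu
  have mPv : ∀ x ∈ Pv, x ≠ u ∧ x ∈ A ∧ G.Adj v x ∧ ¬ G.Adj u x := by
    intro x hx; simp only [Pv, Finset.mem_erase, mem_nn, mem_nb] at hx; tauto
  have mPu : ∀ x ∈ Pu, x ≠ v ∧ x ∈ A ∧ G.Adj u x ∧ ¬ G.Adj v x := by
    intro x hx; simp only [Pu, Finset.mem_erase, mem_nn, mem_nb] at hx; tauto
  obtain ⟨B, hB, hBc⟩ := Finset.exists_subset_card_eq (s := Pv) (n := k.N)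
    (by unfold Cst.p at hpv; omega)
  have hBA : B ⊆ A := fun x hx => (mPv x (hB hx)).2.1
  have hPuA : Pu ⊆ A := fun x hx => (mPu x hx).2.1
  let F := (B.powersetCard s).filter (fun S => Stab G S)
  let bad := Pu.filter (fun x => k.q ≤ (nn G x B).card)
  have hbad : bad ⊆ F.biUnion (fun S => Pu.filter (fun x => ∀ y ∈ S, ¬ G.Adj y x)) := by
    intro x hx
    have hx' := Finset.mem_filter.1 hx
    obtain ⟨S, hS, hSc, hSs⟩ := ramsey (G := G) W s (nn G x B)
      (hA.mono ((nn_sub _ _).trans hBA)) (by rw [← k.hq]; exact hx'.2)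
    refine Finset.mem_biUnion.2 ⟨S, ?_, ?_⟩
    · exact Finset.mem_filter.2 ⟨Finset.mem_powersetCard.2 ⟨hS.trans (nn_sub _ _), hSc⟩, hSs⟩
    · refine Finset.mem_filter.2 ⟨hx'.1, fun y hy h => ?_⟩
      exact (mem_nn.1 (hS hy)).2 h.symm
  have hbadc : bad.card ≤ k.N ^ s * k.q := by
    have e1 : (F.biUnion (fun S => Pu.filter (fun x => ∀ y ∈ S, ¬ G.Adj y x))).card
        ≤ F.card * k.q := by
      apply Finset.card_biUnion_le_card_mul
      intro S hS
      obtain ⟨hS1, hS2⟩ := Finset.mem_filter.1 hS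
      obtain ⟨hS3, hS4⟩ := Finset.mem_powersetCard.1 hS1
      rw [k.hq]
      refine (crowd hG huv.symm (hA.mono ((Finset.filter_subset _ _).trans hPuA)) hS4 hS2
        ?_ ?_ ?_ ?_ ?_ ?_ ?_).le
      · exact fun x hx y hy => (Finset.mem_filter.1 hy).2 x hx
      · exact fun x hx => (mPv x (hB (hS3 hx))).2.2.1
      · exact fun x hx => (mPv x (hB (hS3 hx))).2.2.2
      · exact fun x hx => (mPu x (Finset.mem_filter.1 hx).1).2.2.1
      · exact fun x hx => (mPu x (Finset.mem_filter.1 hx).1).2.2.2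
      · exact fun hx => (mPv u (hB (hS3 hx))).1 rfl
      · exact fun hx => (mPu v (Finset.mem_filter.1 hx).1).1 rfl
    have e2 : F.card ≤ k.N ^ s := by
      refine (Finset.card_filter_le _ _).trans ?_
      rw [Finset.card_powersetCard, hBc]
      exact Nat.choose_le_pow _ _
    exact ((Finset.card_le_card hbad).trans e1).trans (Nat.mul_le_mul_right _ e2)
  have hgood : k.N ≤ (Pu \ bad).card := by
    have e := Finset.le_card_sdiff bad Pu
    unfold Cst.p at hpu; omega
  obtain ⟨C, hC, hCc⟩ := Finset.exists_subset_card_eq hgood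
  have hCPu : C ⊆ Pu := hC.trans Finset.sdiff_subset
  have hCq : ∀ x ∈ C, (nn G x B).card < k.q := by
    intro x hx
    have := Finset.mem_sdiff.1 (hC hx)
    by_contra hcon
    push Not at hcon
    exact this.2 (Finset.mem_filter.2 ⟨this.1, hcon⟩)
  have hqb := k.hqb
  have hb := k.hb
  have hba := k.hba
  let B' := B.filter (fun y => (nn G y C).card ≤ k.a)
  have hB'B : B' ⊆ B := Finset.filter_subset _ _
  have hB'c : B.card ≤ B'.card + k.c := by
    have e1 : B ⊆ B' ∪ B.filter (fun y => k.a < (nn G y C).card) := by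
      intro y hy
      simp only [B', Finset.mem_union, Finset.mem_filter, hy, true_and]
      omega
    have e2 := card_le_add_of_cover e1
    have e3 := trim_lemma (G := G) (P := C) (Q := B) (b := k.b) (c := k.c) k.a_pos
      (fun x hx => by have := hCq x hx; omega) hCc.le k.hNb
    omega
  have hdis : Disjoint C B' := by
    rw [Finset.disjoint_left]
    intro x hx hx'
    exact (mPv x (hB (hB'B hx'))).2.2.2 (mPu x (hCPu hx)).2.2.1
  have hUN := k.UN
  have hac := k.hac
  refine ⟨fun t => if t then C else B', ?_, ?_⟩
  · exact
    { sub0 := by simp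
      sub := by
        rintro (_ | _)
        · simpa using hB'B.trans hBA
        · simpa using hCPu.trans hPuA
      clique := by simp
      compl := by simp
      disj := by
        rintro (_ | _) (_ | _) hne
        · exact (hne rfl).elim
        · simpa using hdis.symm
        · simpa using hdis
        · exact (hne rfl).elim
      le := by
        rintro (_ | _)
        · simpa [← hBc] using Finset.card_le_card hB'B
        · simpa using hCc.le
      dense := by
        rintro (_ | _) (_ | _) hne x hx
        · exact (hne rfl).elim
        · simp only [Bool.false_eq_true, if_false] at hx
          simpa using (Finset.mem_filter.1 hx).2
        · simp only [if_true] at hx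
          have e1 := hCq x hx
          have e2 := Finset.card_le_card (nn_mono (G := G) x hB'B)
          simp only [Bool.false_eq_true, if_false]
          omega
        · exact (hne rfl).elim
      big := by
        rintro (_ | _)
        · simp only [Bool.false_eq_true, if_false]; omega
        · simp only [if_true]; omega }
  · simp only [val, Fintype.sum_bool, if_true, Bool.false_eq_true, if_false, Finset.card_empty]
    have h1 := k.hzN
    have h2 := k.hz
    have hW := k.hW
    have h3 : 5 * 1 * k.U ≤ 5 * W * k.U := by gcongr
    have h4 : 1 * k.z ≤ (W+1) * k.z := by gcongr; omega
    omega

lemma exists_opt (hG : IsInducedFree G (doubleStarGraph s)) (hA : CliqueLe G A W)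
    (hne : A.Nonempty) (hdeg : ∀ v ∈ A, k.d0 < (nb G v A).card) :
    ∃ (ι : Type) (_ : Fintype ι) (L0 : Finset V) (L : ι → Finset V),
      Templ k G A L0 L ∧ MaxVal k G A (val k L0 L) ∧ 2 ≤ Fintype.card ι := by
  obtain ⟨L2, hL2, hv2⟩ := kst_templ hG hA hne hdeg
  let S : Set ℕ := {n | ∃ (ι : Type) (_ : Fintype ι) (L0 : Finset V) (L : ι → Finset V),
    Templ k G A L0 L ∧ val k L0 L = n}
  have hSb : BddAbove S := by
    refine ⟨k.X0, ?_⟩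
    rintro n ⟨ι, _, L0, L, h, rfl⟩
    exact h.val_le hA
  have hSn : S.Nonempty := ⟨_, Bool, inferInstance, ∅, L2, hL2, rfl⟩
  obtain ⟨ι, iι, L0, L, h, hval⟩ := Nat.sSup_mem hSn hSb
  have hmax : MaxVal k G A (val k L0 L) := by
    intro ι' _ L0' L' h'
    rw [hval]
    exact le_csSup hSb ⟨ι', inferInstance, L0', L', h', rfl⟩
  refine ⟨ι, iι, L0, L, h, hmax, ?_⟩
  by_contra hlt
  have h3 : ∑ i, ((L i).card + k.U) ≤ Fintype.card ι * (k.N + k.U) := by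
    rw [← Finset.card_univ, ← smul_eq_mul]
    exact Finset.sum_le_card_nsmul _ _ _ (fun i _ => Nat.add_le_add_right (h.le i) _)
  have h4 : Fintype.card ι * (k.N + k.U) ≤ 1 * (k.N + k.U) :=
    Nat.mul_le_mul_right _ (by omega)
  have h5 := Nat.mul_le_mul_left k.lam (h.card0 hA)
  have h6 := hmax _ _ _ hL2
  unfold val at h6 hv2
  omega
end DStar


namespace DStar
open scoped Classical
variable {V : Type} {G : SimpleGraph V} {s W : ℕ}

/-- Standing assumptions. -/
structure Ctx (k : Cst s W) (G : SimpleGraph V) (A : Finset V) {ι : Type} [Fintype ι]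
    (L0 : Finset V) (L : ι → Finset V) : Prop where
  free : IsInducedFree G (doubleStarGraph s)
  cl : CliqueLe G A W
  templ : Templ k G A L0 L
  max : MaxVal k G A (val k L0 L)
  two : 2 ≤ Fintype.card ι

/-- Union of the parts. -/
noncomputable def UL {ι : Type} [Fintype ι] (L : ι → Finset V) : Finset V :=
  Finset.univ.biUnion L

/-- Indices on which `y` is not full. -/
noncomputable def KK (k : Cst s W) (G : SimpleGraph V) {ι : Type} [Fintype ι]
    (L : ι → Finset V) (y : V) : Finset ι :=
  Finset.univ.filter (fun i => k.b ≤ (nn G y (L i)).card)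

/-- Vertices full everywhere. -/
noncomputable def ZZ (k : Cst s W) (G : SimpleGraph V) (A : Finset V) {ι : Type} [Fintype ι]
    (L : ι → Finset V) : Finset V :=
  A.filter (fun y => y ∉ UL L ∧ KK k G L y = ∅)

/-- The closed neighbourhood without `Z`. -/
noncomputable def YY (k : Cst s W) (G : SimpleGraph V) (A : Finset V) {ι : Type} [Fintype ι]
    (L : ι → Finset V) : Finset V :=
  A.filter (fun y => y ∈ UL L ∨ (KK k G L y ≠ ∅ ∧ ∃ u ∈ UL L, G.Adj y u))

/-- Pendant triples. -/
def PT (s : ℕ) (G : SimpleGraph V) (t : V × V × Finset V) (y : V) : Prop :=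
  Stab G t.2.2 ∧ t.2.2.card = s ∧ (∀ a ∈ t.2.2, G.Adj t.1 a) ∧ t.2.1 ∉ t.2.2 ∧
  (∀ a ∈ t.2.2, ¬ G.Adj t.2.1 a) ∧ G.Adj t.1 t.2.1 ∧ ¬ G.Adj y t.1 ∧ G.Adj y t.2.1 ∧
  (∀ a ∈ t.2.2, ¬ G.Adj y a)

/-- Index set of pendant triples. -/
noncomputable def PI (s : ℕ) {ι : Type} [Fintype ι]
    (L : ι → Finset V) : Finset (V × V × Finset V) :=
  UL L ×ˢ UL L ×ˢ (UL L).powersetCard s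

/-- Pendant vertices. -/
noncomputable def Pend (s : ℕ) (G : SimpleGraph V) (A : Finset V) {ι : Type} [Fintype ι]
    (L : ι → Finset V) : Finset V :=
  (PI s L).biUnion (fun t => A.filter (fun y => y ∉ UL L ∧ PT s G t y))

/-- Nearly full but twice non-full vertices. -/
noncomputable def QQ (k : Cst s W) (G : SimpleGraph V) (A : Finset V) {ι : Type} [Fintype ι]
    (L : ι → Finset V) : Finset V :=
  A.filter (fun y => y ∉ UL L ∧ y ∉ Pend s G A L ∧ (∀ i, (nn G y (L i)).card < 3 * k.a) ∧
    2 ≤ (KK k G L y).card)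

variable {k : Cst s W} {A : Finset V} {ι : Type} [Fintype ι] {L0 : Finset V} {L : ι → Finset V}

lemma mem_UL {x : V} : x ∈ UL L ↔ ∃ i, x ∈ L i := by simp [UL]
lemma L_sub_UL (i : ι) : L i ⊆ UL L := fun x hx => mem_UL.2 ⟨i, hx⟩
lemma mem_KK {y : V} {i : ι} : i ∈ KK k G L y ↔ k.b ≤ (nn G y (L i)).card := by simp [KK]

namespace Ctx

lemma ULA (h : Ctx k G A L0 L) : UL L ⊆ A := fun x hx => by
  obtain ⟨i, hi⟩ := mem_UL.1 hx; exact h.templ.sub i hi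

lemma cardUL (h : Ctx k G A L0 L) : (UL L).card ≤ W * k.N := by
  have h1 : (UL L).card ≤ (Finset.univ : Finset ι).card * k.N :=
    Finset.card_biUnion_le_card_mul _ _ _ (fun i _ => h.templ.le i)
  rw [Finset.card_univ] at h1
  exact h1.trans (Nat.mul_le_mul_right _ (h.templ.cardι h.cl))

lemma disj_of (h : Ctx k G A L0 L) {M : Finset V} (hM : ∀ y ∈ M, y ∉ UL L) (i : ι) :
    Disjoint M (L i) := by
  rw [Finset.disjoint_left]
  exact fun y hy hi => hM y hy (L_sub_UL i hi)

lemma cardZ (h : Ctx k G A L0 L) : (ZZ k G A L).card < k.N := by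
  refine combine_small h.templ h.cl h.max L (fun i => le_rfl) (fun i => by omega)
    (Finset.filter_subset _ _) (h.disj_of (fun y hy => (Finset.mem_filter.1 hy).2.1)) ?_
  intro v hv i
  have := (Finset.mem_filter.1 hv).2.2
  by_contra hcon
  have hi : i ∈ KK k G L v := mem_KK.2 (by omega)
  rw [this] at hi
  simp at hi

lemma exists_ne (h : Ctx k G A L0 L) (j : ι) : ∃ i, i ≠ j := by
  have : Nontrivial ι := Fintype.one_lt_card_iff_nontrivial.1 h.two
  exact _root_.exists_ne j

lemma far (h : Ctx k G A L0 L) {y u0 : V} (hy : y ∉ UL L) (hK : KK k G L y ≠ ∅)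
    (hu0 : u0 ∈ UL L) (hyu0 : G.Adj y u0) {F : Finset V} (hF : F ⊆ A)
    (hFy : ∀ x ∈ F, G.Adj y x) (hFU : ∀ x ∈ F, x ∉ UL L)
    (hFn : ∀ x ∈ F, ∀ u ∈ UL L, ¬ G.Adj x u) : F.card < k.q := by
  have hqb := k.hqb
  have hb := k.hb
  have hba := k.hba
  have h10 := k.h10
  have main : ∀ u ∈ UL L, G.Adj y u → ∀ Q ⊆ UL L, k.q ≤ Q.card → (∀ x ∈ Q, G.Adj u x) →
      (∀ x ∈ Q, ¬ G.Adj y x) → F.card < k.q := by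
    intro u hu hyu Q hQ hQc hQu hQy
    rw [k.hq] at hQc ⊢
    exact crowd2 h.free hyu.symm (h.cl.mono hF) (h.cl.mono (hQ.trans h.ULA)) hQc
      (fun x hx z hz hxz => hFn z hz x (hQ hx) hxz.symm) hQu hQy hFy
      (fun x hx hux => hFn x hx u hu hux.symm) (fun hyQ => hy (hQ hyQ)) (fun hF => hFU u hF hu)
  by_cases hc : ∃ j ∈ KK k G L y, ∃ i, i ≠ j ∧ 3 * k.a ≤ (nb G y (L i)).card
  · obtain ⟨j, hj, i, hij, hi⟩ := hc
    obtain ⟨u, hu, hub⟩ := avg_lemma (G := G) (P := nn G y (L j)) (Q := nb G y (L i)) k.a_pos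
      k.b1_pos (fun x hx => (Finset.card_le_card (nn_mono x (nb_sub _ _))).trans
        (h.templ.dense j i (Ne.symm hij) x (nn_sub _ _ hx))) hi (by rw [← hb]; exact mem_KK.1 hj)
    rw [mem_nb] at hu
    refine main u (L_sub_UL i hu.1) hu.2 (nb G u (nn G y (L j)))
      ((nb_sub _ _).trans ((nn_sub _ _).trans (L_sub_UL j))) (by omega)
      (fun x hx => (mem_nb.1 hx).2) (fun x hx => (mem_nn.1 (mem_nb.1 hx).1).2)
  · push Not at hc
    obtain ⟨j0, hj0⟩ := Finset.nonempty_iff_ne_empty.2 hK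
    have hall : ∀ i, (nb G y (L i)).card < 3 * k.a := by
      intro i
      by_cases hi : i = j0
      · subst hi
        obtain ⟨i', hi'⟩ := h.exists_ne i
        have e1 := hc i hj0 i' hi'
        have e2 := nb_add_nn (G := G) y (L i')
        have e3 := h.templ.big i'
        exact hc i' (mem_KK.2 (by omega)) i (Ne.symm hi')
      · exact hc j0 hj0 i hi
    obtain ⟨i, hi⟩ := mem_UL.1 hu0
    obtain ⟨j, hj⟩ := h.exists_ne i
    refine main u0 hu0 hyu0 (nn G y (nb G u0 (L j)))
      ((nn_sub _ _).trans ((nb_sub _ _).trans (L_sub_UL j))) ?_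
      (fun x hx => (mem_nb.1 (mem_nn.1 hx).1).2) (fun x hx => (mem_nn.1 hx).2)
    have e1 := nb_add_nn (G := G) y (nb G u0 (L j))
    have e2 := nb_add_nn (G := G) u0 (L j)
    have e3 := h.templ.dense i j (Ne.symm hj) u0 hi
    have e4 := h.templ.big j
    have e5 : (nb G y (nb G u0 (L j))).card ≤ (nb G y (L j)).card :=
      Finset.card_le_card (Finset.filter_subset_filter _ (nb_sub _ _))
    have e6 := hall j
    omega

/-- Few neighbours outside. -/
lemma out (h : Ctx k G A L0 L) {y : V} (hy : y ∈ YY k G A L) :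
    ((A \ YY k G A L).filter (fun x => G.Adj y x)).card ≤ k.q + k.N := by
  let F := (A \ YY k G A L).filter (fun x => G.Adj y x ∧ x ∉ UL L ∧ ∀ u ∈ UL L, ¬ G.Adj x u)
  have hcov : (A \ YY k G A L).filter (fun x => G.Adj y x) ⊆ F ∪ ZZ k G A L := by
    intro x hx
    simp only [YY, Finset.mem_filter, Finset.mem_sdiff, not_and, not_or, not_exists] at hx
    simp only [F, ZZ, YY, Finset.mem_union, Finset.mem_filter, Finset.mem_sdiff, not_and, not_or,
      not_exists]
    have := hx.1.2 hx.1.1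
    by_cases hK : KK k G L x = ∅
    · right; exact ⟨hx.1.1, this.1, hK⟩
    · left; exact ⟨hx.1, hx.2, this.1, this.2 hK⟩
  have h1 := card_le_add_of_cover hcov
  have h2 := h.cardZ
  have h3 : F.card ≤ k.q := by
    rcases (Finset.mem_filter.1 hy).2 with hyU | ⟨hK, u, hu, hyu⟩
    · have : F = ∅ := by
        rw [Finset.eq_empty_iff_forall_notMem]
        intro x hx
        have := (Finset.mem_filter.1 hx).2
        exact this.2.2 y hyU this.1.symm
      rw [this]; simp
    · by_cases hyU : y ∈ UL L
      · have : F = ∅ := by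
          rw [Finset.eq_empty_iff_forall_notMem]
          intro x hx
          have := (Finset.mem_filter.1 hx).2
          exact this.2.2 y hyU this.1.symm
        rw [this]; simp
      · refine (h.far hyU hK hu hyu ((Finset.filter_subset _ _).trans Finset.sdiff_subset)
          ?_ ?_ ?_).le
        · exact fun x hx => (Finset.mem_filter.1 hx).2.1
        · exact fun x hx => (Finset.mem_filter.1 hx).2.2.1
        · exact fun x hx => (Finset.mem_filter.1 hx).2.2.2
  omega

lemma cardPend (h : Ctx k G A L0 L) : (Pend s G A L).card ≤ (W * k.N) ^ (s+2) * k.q := by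
  have h1 : (Pend s G A L).card ≤ (PI s L).card * k.q := by
    apply Finset.card_biUnion_le_card_mul
    rintro ⟨u, x, S⟩ ht
    simp only [PI, Finset.mem_product] at ht
    by_cases hne : (A.filter (fun y => y ∉ UL L ∧ PT s G (u, x, S) y)).Nonempty
    · obtain ⟨y0, hy0⟩ := hne
      have hp := (Finset.mem_filter.1 hy0).2.2
      simp only [PT] at hp
      rw [k.hq]
      refine (crowd h.free hp.2.2.2.2.2.1 (h.cl.mono (Finset.filter_subset _ _)) hp.2.1 hp.1
        ?_ hp.2.2.1 hp.2.2.2.2.1 ?_ ?_ hp.2.2.2.1 ?_).le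
      · intro z hz y hy hzy
        have := (Finset.mem_filter.1 hy).2.2
        simp only [PT] at this
        exact this.2.2.2.2.2.2.2.2 z hz hzy.symm
      · intro y hy
        have := (Finset.mem_filter.1 hy).2.2
        simp only [PT] at this
        exact this.2.2.2.2.2.2.2.1.symm
      · intro y hy hh
        have := (Finset.mem_filter.1 hy).2.2
        simp only [PT] at this
        exact this.2.2.2.2.2.2.1 hh.symm
      · exact fun hu => (Finset.mem_filter.1 hu).2.1 ht.1
    · rw [Finset.not_nonempty_iff_eq_empty.1 hne]; simp
  refine h1.trans (Nat.mul_le_mul_right _ ?_)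
  simp only [PI, Finset.card_product, Finset.card_powersetCard]
  have h2 : (UL L).card.choose s ≤ (W * k.N)^s :=
    (Nat.choose_le_pow _ _).trans (Nat.pow_le_pow_left h.cardUL _)
  calc _ ≤ (W * k.N) * ((W * k.N) * (W * k.N)^s) :=
        Nat.mul_le_mul h.cardUL (Nat.mul_le_mul h.cardUL h2)
    _ = _ := by ring

lemma dich (h : Ctx k G A L0 L) {y u : V} {i j : ι} (hyA : y ∈ A) (hy : y ∉ UL L)
    (hp : y ∉ Pend s G A L) (hu : u ∈ L j) (hyu : ¬ G.Adj y u) (hij : i ≠ j) :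
    nb G u (nb G y (L i)) = ∅ ∨ (nb G u (nn G y (L i))).card < k.b1 := by
  by_cases hne : (nb G u (nb G y (L i))).Nonempty
  · right
    refine prime h.templ h.cl h.max ((nb_sub _ _).trans (nb_sub _ _))
      ((nb_sub _ _).trans (nn_sub _ _)) ?_ ?_ hne ?_
    · rw [Finset.disjoint_left]
      intro x hx hx'
      simp only [mem_nb, mem_nn] at hx hx'
      tauto
    · have e1 := nb_add_nn (G := G) u (L i)
      have e2 := h.templ.dense j i (Ne.symm hij) u hu
      have e3 : nb G u (L i) ⊆ nb G u (nb G y (L i)) ∪ nb G u (nn G y (L i)) := by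
        intro x hx
        simp only [Finset.mem_union, mem_nb, mem_nn] at hx ⊢
        tauto
      have e4 := card_le_add_of_cover e3
      omega
    · intro x hx
      by_contra hcon
      push Not at hcon
      have hsub : nb G u (nn G y (L i)) ⊆ L i := (nb_sub _ _).trans (nn_sub _ _)
      obtain ⟨S, hS, hSc, hSs⟩ := ramsey (G := G) W s (nn G x (nb G u (nn G y (L i))))
        (h.cl.mono ((nn_sub _ _).trans (hsub.trans (h.templ.sub i)))) (by rw [← k.hq]; exact hcon)
      have mS : ∀ z ∈ S, z ∈ L i ∧ ¬ G.Adj x z ∧ G.Adj u z ∧ ¬ G.Adj y z := by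
        intro z hz
        have := hS hz
        simp only [mem_nn, mem_nb] at this
        tauto
      simp only [mem_nb] at hx
      apply hp
      refine Finset.mem_biUnion.2 ⟨(u, x, S), ?_, ?_⟩
      · simp only [PI, Finset.mem_product, Finset.mem_powersetCard]
        exact ⟨L_sub_UL j hu, L_sub_UL i hx.1.1, fun z hz => L_sub_UL i (mS z hz).1, hSc⟩
      · refine Finset.mem_filter.2 ⟨hyA, hy, hSs, hSc, fun z hz => (mS z hz).2.2.1,
          fun hxS => (mS x hxS).2.2.2 hx.1.2, fun z hz => (mS z hz).2.1, hx.2, hyu, hx.1.2,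
          fun z hz => (mS z hz).2.2.2⟩
  · left; exact Finset.not_nonempty_iff_eq_empty.1 hne

lemma nb_ge (h : Ctx k G A L0 L) {u : V} {i j : ι} (hu : u ∈ L j) (hij : i ≠ j) :
    (L i).card ≤ (nb G u (L i)).card + k.a := by
  have e1 := nb_add_nn (G := G) u (L i)
  have e2 := h.templ.dense j i (Ne.symm hij) u hu
  omega

lemma dich' (h : Ctx k G A L0 L) {y u : V} {i j : ι} (hyA : y ∈ A) (hy : y ∉ UL L)
    (hp : y ∉ Pend s G A L) (hu : u ∈ nn G y (L j)) (hij : i ≠ j)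
    (hsm : (nn G y (L i)).card < 3 * k.a) : (nn G y (nb G u (L i))).card ≤ k.b := by
  rw [mem_nn] at hu
  have e : nn G y (nb G u (L i)) = nb G u (nn G y (L i)) := by
    ext x; simp only [mem_nn, mem_nb]; tauto
  rw [e]
  rcases h.dich hyA hy hp hu.1 hu.2 hij with h1 | h1
  · exfalso
    have e1 := h.nb_ge hu.1 hij
    have e3 : nb G u (L i) ⊆ nb G u (nb G y (L i)) ∪ nn G y (L i) := by
      intro x hx
      simp only [Finset.mem_union, mem_nb, mem_nn] at hx ⊢
      tauto
    have e4 := card_le_add_of_cover e3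
    rw [h1] at e4
    have e5 := h.templ.big i
    have := k.h10
    have := k.a_pos
    simp at e4
    omega
  · have := k.hb; omega

lemma cardQ (h : Ctx k G A L0 L) : (QQ k G A L).card ≤ W * (W * k.N)^2 * k.N := by
  let M : ι × V × V → Finset V := fun t => A.filter (fun y => y ∉ UL L ∧ t.2.1 ∈ L t.1 ∧
    (∃ i, i ≠ t.1 ∧ t.2.2 ∈ L i) ∧ (∀ l, l ≠ t.1 → (nn G y (nb G t.2.1 (L l))).card ≤ k.b) ∧
    (nn G y (nb G t.2.2 (L t.1))).card ≤ k.b)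
  have hcov : QQ k G A L ⊆
      ((Finset.univ : Finset ι) ×ˢ UL L ×ˢ UL L).biUnion M := by
    intro y hy
    obtain ⟨hyA, hyU, hyP, hsm, hK⟩ := Finset.mem_filter.1 hy
    obtain ⟨i, hi, j, hj, hij⟩ := Finset.one_lt_card.1 hK
    have hne : ∀ l ∈ KK k G L y, (nn G y (L l)).Nonempty := by
      intro l hl
      rw [← Finset.card_pos]
      exact lt_of_lt_of_le k.b_pos (mem_KK.1 hl)
    obtain ⟨u, hu⟩ := hne j hj
    obtain ⟨u', hu'⟩ := hne i hi
    have hu1 := nn_sub _ _ hu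
    have hu2 := nn_sub _ _ hu'
    refine Finset.mem_biUnion.2 ⟨(j, u, u'), ?_, ?_⟩
    · simp only [Finset.mem_product, Finset.mem_univ, true_and]
      exact ⟨L_sub_UL j hu1, L_sub_UL i hu2⟩
    · refine Finset.mem_filter.2 ⟨hyA, hyU, hu1, ⟨i, hij, hu2⟩, ?_, ?_⟩
      · exact fun l hl => h.dich' hyA hyU hyP hu hl (hsm l)
      · exact h.dich' hyA hyU hyP hu' (Ne.symm hij) (hsm j)
  have h1 : (((Finset.univ : Finset ι) ×ˢ UL L ×ˢ UL L).biUnion M).card ≤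
      ((Finset.univ : Finset ι) ×ˢ UL L ×ˢ UL L).card * k.N := by
    apply Finset.card_biUnion_le_card_mul
    rintro ⟨j, u, u'⟩ -
    by_cases hne : (M (j, u, u')).Nonempty
    · obtain ⟨y0, hy0⟩ := hne
      obtain ⟨-, -, hu, ⟨i, hij, hu'⟩, -⟩ := Finset.mem_filter.1 hy0
      simp only at hu hij hu'
      refine (combine_small h.templ h.cl h.max
        (fun l => if l = j then nb G u' (L l) else nb G u (L l)) ?_ ?_
        (Finset.filter_subset _ _) (h.disj_of (fun y hy => (Finset.mem_filter.1 hy).2.1)) ?_).le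
      · intro l; split_ifs <;> exact nb_sub _ _
      · intro l
        by_cases hl : l = j
        · subst hl; simp only [if_true]; exact h.nb_ge hu' (Ne.symm hij)
        · simp only [hl, if_false]; exact h.nb_ge hu hl
      · intro y hy l
        obtain ⟨-, -, -, -, h3, h4⟩ := Finset.mem_filter.1 hy
        by_cases hl : l = j
        · subst hl; simpa using h4
        · simpa [hl] using h3 l hl
    · rw [Finset.not_nonempty_iff_eq_empty.1 hne]; simp
  refine ((Finset.card_le_card hcov).trans h1).trans (Nat.mul_le_mul_right _ ?_)
  simp only [Finset.card_product, Finset.card_univ]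
  calc _ ≤ W * ((W * k.N) * (W * k.N)) :=
        Nat.mul_le_mul (h.templ.cardι h.cl) (Nat.mul_le_mul h.cardUL h.cardUL)
    _ = _ := by ring

lemma claim1 (h : Ctx k G A L0 L) {y : V} {i j : ι} (hyA : y ∈ A) (hy : y ∉ UL L)
    (hp : y ∉ Pend s G A L) (hij : i ≠ j) (hj : 3 * k.a ≤ (nn G y (L j)).card)
    (hi : i ∈ KK k G L y) : nb G y (L i) = ∅ := by
  rw [mem_KK] at hi
  by_contra hne
  obtain ⟨x, hx⟩ := Finset.nonempty_iff_ne_empty.2 hne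
  have hb := k.hb
  have hba := k.hba
  have h10 := k.h10
  have ha := k.a_pos
  obtain ⟨u, hu, hub⟩ := avg_lemma (G := G) (P := nn G y (L i)) (Q := nn G y (L j)) k.a_pos
    k.b1_pos (fun x hx => (Finset.card_le_card (nn_mono x (nn_sub _ _))).trans
      (h.templ.dense i j hij x (nn_sub _ _ hx))) hj (by rw [← hb]; exact hi)
  rw [mem_nn] at hu
  have hU := h.templ.big i
  have hpi : k.U ≤ (nn G y (L i)).card + k.a := by
    rcases h.dich hyA hy hp hu.1 hu.2 hij with h1 | h1
    · have e1 := nb_add_nn (G := G) y (L i)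
      have e2 : nb G y (L i) ⊆ nn G u (L i) := by
        intro z hz
        rw [mem_nb] at hz
        rw [mem_nn]
        refine ⟨hz.1, fun huz => ?_⟩
        have : z ∈ nb G u (nb G y (L i)) := by simp [mem_nb, hz, huz]
        rw [h1] at this
        simp at this
      have e3 := Finset.card_le_card e2
      have e4 := h.templ.dense j i (Ne.symm hij) u hu.1
      omega
    · omega
  have hx' := mem_nb.1 hx
  have e1 := nb_add_nn (G := G) x (nn G y (L j))
  have e2 := Finset.card_le_card (nn_mono (G := G) x (nn_sub (G := G) y (L j)))
  have e3 := h.templ.dense i j hij x hx'.1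
  obtain ⟨u2, hu2⟩ : (nb G x (nn G y (L j))).Nonempty := by
    rw [← Finset.card_pos]; omega
  simp only [mem_nb, mem_nn] at hu2
  rcases h.dich hyA hy hp hu2.1.1 hu2.1.2 hij with h1 | h1
  · have : x ∈ nb G u2 (nb G y (L i)) := by simp [mem_nb, hx', hu2.2.symm]
    rw [h1] at this
    simp at this
  · have e5 := nb_add_nn (G := G) u2 (nn G y (L i))
    have e6 := Finset.card_le_card (nn_mono (G := G) u2 (nn_sub (G := G) y (L i)))
    have e7 := h.templ.dense j i (Ne.symm hij) u2 hu2.1.1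
    omega

lemma typeLemma (h : Ctx k G A L0 L) {y : V} (hyA : y ∈ A) (hy : y ∉ UL L)
    (hp : y ∉ Pend s G A L) (hq : y ∉ QQ k G A L) (hK : 2 ≤ (KK k G L y).card) :
    ∀ i ∈ KK k G L y, nb G y (L i) = ∅ := by
  have hj : ∃ j, 3 * k.a ≤ (nn G y (L j)).card := by
    by_contra hcon
    push Not at hcon
    exact hq (Finset.mem_filter.2 ⟨hyA, hy, hp, hcon, hK⟩)
  obtain ⟨j, hj⟩ := hj
  have hjK : j ∈ KK k G L y := mem_KK.2 (by have := k.hba; omega)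
  intro l hl
  by_cases hlj : l = j
  · subst hlj
    obtain ⟨i, hi, hil⟩ := Finset.exists_mem_ne (s := KK k G L y) (by omega) l
    have e1 := h.claim1 hyA hy hp hil hj hi
    refine h.claim1 hyA hy hp (Ne.symm hil) ?_ hl
    have e2 := nb_add_nn (G := G) y (L i)
    have e3 := h.templ.big i
    rw [e1] at e2
    have := k.h10
    simp at e2
    omega
  · exact h.claim1 hyA hy hp hlj hj hl

lemma type_ne_univ (h : Ctx k G A L0 L) {y : V} (hyA : y ∈ A) (hy : y ∉ UL L)
    (hp : y ∉ Pend s G A L) (hq : y ∉ QQ k G A L) (hn : ∃ u ∈ UL L, G.Adj y u) :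
    ∃ l, l ∉ KK k G L y := by
  by_contra hcon
  push Not at hcon
  have e : KK k G L y = Finset.univ := Finset.eq_univ_of_forall hcon
  obtain ⟨u, hu, hyu⟩ := hn
  obtain ⟨i, hi⟩ := mem_UL.1 hu
  have := h.typeLemma hyA hy hp hq (by rw [e, Finset.card_univ]; exact h.two) i (hcon i)
  have hm : u ∈ nb G y (L i) := mem_nb.2 ⟨hi, hyu⟩
  rw [this] at hm
  simp at hm

lemma badLemma (h : Ctx k G A L0 L) {y : V} (hy : y ∉ UL L) {l m : ι}
    (hl : l ∉ KK k G L y) (hm : m ∈ KK k G L y) {F : Finset V} (hF : F ⊆ A)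
    (hFU : ∀ x ∈ F, x ∉ UL L) (hFy : ∀ x ∈ F, G.Adj y x)
    (hFl : ∀ x ∈ F, nb G x (L l) = ∅) (hFm : ∀ x ∈ F, nb G x (L m) = ∅) : F.card < k.q := by
  have hlm : l ≠ m := fun e => hl (e ▸ hm)
  rw [mem_KK] at hl hm
  have hb := k.hb
  have hba := k.hba
  have h10 := k.h10
  have hqb := k.hqb
  have e1 := nb_add_nn (G := G) y (L l)
  have e2 := h.templ.big l
  have noadj : ∀ x j, nb G x (L j) = ∅ → ∀ z ∈ L j, ¬ G.Adj x z := by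
    intro x j e z hz hxz
    have : z ∈ nb G x (L j) := mem_nb.2 ⟨hz, hxz⟩
    rw [e] at this
    simp at this
  obtain ⟨u, hu, hub⟩ := avg_lemma (G := G) (P := nn G y (L m)) (Q := nb G y (L l)) k.a_pos
    k.b1_pos (fun x hx => (Finset.card_le_card (nn_mono x (nb_sub _ _))).trans
      (h.templ.dense m l (Ne.symm hlm) x (nn_sub _ _ hx))) (by omega) (by omega)
  rw [mem_nb] at hu
  have hsub : nb G u (nn G y (L m)) ⊆ L m := (nb_sub _ _).trans (nn_sub _ _)
  rw [k.hq]
  refine crowd2 h.free hu.2.symm (h.cl.mono hF) (h.cl.mono (hsub.trans (h.templ.sub m)))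
    (by rw [← k.hq]; omega) ?_ (fun x hx => (mem_nb.1 hx).2)
    (fun x hx => (mem_nn.1 (mem_nb.1 hx).1).2) hFy ?_ ?_ ?_
  · exact fun x hx z hz hxz => noadj z m (hFm z hz) x (hsub hx) hxz.symm
  · exact fun x hx hux => noadj x l (hFl x hx) u hu.1 hux.symm
  · exact fun hyQ => hy (L_sub_UL m (hsub hyQ))
  · exact fun huF => hFU u huF (L_sub_UL l hu.1)

lemma clique_drop (h : Ctx k G A L0 L) {w : ℕ} (hw : CliqueLe G A w) {l : ι} {M : Finset V}
    (hM : M ⊆ A) (hl : ∀ y ∈ M, l ∉ KK k G L y) {K : Finset V} (hK : K ⊆ M)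
    (hKc : G.IsClique (K : Set V)) : K.card + 1 ≤ w := by
  have h1 : (K.biUnion (fun y => nn G y (L l))).card ≤ K.card * k.b := by
    apply Finset.card_biUnion_le_card_mul
    intro y hy
    have := hl y (hK hy)
    rw [mem_KK] at this
    omega
  have h2 := Nat.mul_le_mul_right k.b (h.cl K (hK.trans hM) hKc)
  have h3 := k.Wb_lt
  have h4 := h.templ.big l
  obtain ⟨x, hx, hxn⟩ := Finset.exists_mem_notMem_of_card_lt_card
    (s := K.biUnion (fun y => nn G y (L l))) (t := L l) (by omega)
  have hadj : ∀ v ∈ K, G.Adj v x := by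
    intro v hv
    by_contra hh
    exact hxn (Finset.mem_biUnion.2 ⟨v, hv, mem_nn.2 ⟨hx, hh⟩⟩)
  have hxK : x ∉ K := fun hh => (hadj x hh).ne rfl
  have := hw (insert x K) (Finset.insert_subset (h.templ.sub l hx) (hK.trans hM)) (by
    rw [Finset.coe_insert, SimpleGraph.isClique_insert]
    exact ⟨hKc, fun b hb _ => (hadj b hb).symm⟩)
  rwa [Finset.card_insert_of_notMem hxK] at this

end Ctx
end DStar


namespace DStar
open scoped Classical
variable {V : Type} {G : SimpleGraph V} {s W : ℕ}

/-- number of special colours -/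
def Cst.B0 (k : Cst s W) : ℕ :=
  W * k.N + (W * k.N)^(s+2) * k.q + W * (W * k.N)^2 * k.N
/-- colour constant -/
def Cst.CC (k : Cst s W) : ℕ := k.B0 + W * k.N
/-- outdegree constant -/
def Cst.e (k : Cst s W) : ℕ := k.d0 + (k.q + k.N) + W^2 * k.q

/-- The colouring statement. -/
def Col (k : Cst s W) (G : SimpleGraph V) (A : Finset V) (w X : ℕ) : Prop :=
  ∃ f : V → ℕ, ∃ R : V → V → Prop, (∀ v ∈ A, f v < k.CC * w^3 * X) ∧
    (∀ v ∈ A, (A.filter (fun u => R v u)).card ≤ k.e * w) ∧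
    (∀ u ∈ A, ∀ v ∈ A, G.Adj u v → f u = f v → R u v ∨ R v u)

variable {k : Cst s W} {A : Finset V} {ι : Type} [Fintype ι] {L0 : Finset V} {L : ι → Finset V}

lemma Templ.mono {B : Finset V} (h : Templ k G B L0 L) (hB : B ⊆ A) : Templ k G A L0 L :=
  { h with
    sub0 := h.sub0.trans hB
    sub := fun i => (h.sub i).trans hB }

lemma MaxVal.mono {B : Finset V} {X : ℕ} (h : MaxVal k G A X) (hB : B ⊆ A) : MaxVal k G B X :=
  fun ι _ L0 L hT => h ι L0 L (hT.mono hB)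

lemma maxVal_pos {X : ℕ} (h : MaxVal k G A X) (hA : A.Nonempty) : 1 ≤ X := by
  obtain ⟨v, hv⟩ := hA
  have hT : Templ k G A {v} (fun i : Empty => i.elim) :=
    { sub0 := by simpa using hv
      sub := fun i => i.elim
      clique := by simp
      compl := fun _ _ i => i.elim
      disj := fun i => i.elim
      le := fun i => i.elim
      dense := fun i => i.elim
      big := fun i => i.elim }
  have := h _ _ _ hT
  simp only [val, Finset.card_singleton, mul_one] at this
  have hl := k.hlam
  have : 0 < 10 * k.U * W := by have := k.U_pos; have := k.hW; positivity
  omega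

lemma enc_exists {α : Type} (P : Finset α) : ∃ g : α → ℕ, (∀ x ∈ P, g x < P.card) ∧
    ∀ x ∈ P, ∀ y ∈ P, g x = g y → x = y := by
  refine ⟨fun x => if h : x ∈ P then (P.equivFin ⟨x, h⟩ : ℕ) else 0, ?_, ?_⟩
  · intro x hx
    simp only [hx, dif_pos]
    exact Fin.is_lt _
  · intro x hx y hy h
    simp only [hx, hy, dif_pos] at h
    have := P.equivFin.injective (Fin.ext h)
    simpa using this

lemma dec_exists {α : Type} [Nonempty α] (P : Finset α) {n : ℕ} (hn : n ≤ P.card) :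
    ∃ g : ℕ → α, (∀ m < n, g m ∈ P) ∧ ∀ m < n, ∀ m' < n, g m = g m' → m = m' := by
  refine ⟨fun m => if h : m < P.card then (P.equivFin.symm ⟨m, h⟩ : α)
    else Classical.arbitrary α, ?_, ?_⟩
  · intro m hm
    simp only [lt_of_lt_of_le hm hn, dif_pos]
    exact Subtype.coe_prop _
  · intro m hm m' hm' h
    simp only [lt_of_lt_of_le hm hn, lt_of_lt_of_le hm' hn, dif_pos] at h
    have := P.equivFin.symm.injective (Subtype.ext h)
    simpa using this

lemma col_low {w X : ℕ} (hw : CliqueLe G A w) (hX : MaxVal k G A X) {v : V} (hv : v ∈ A)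
    (hd : (nb G v A).card ≤ k.d0) (ih : Col k G (A.erase v) w X) : Col k G A w X := by
  obtain ⟨f, R, h1, h2, h3⟩ := ih
  have hw1 : 1 ≤ w := by
    have := hw {v} (by simpa using hv) (by simp)
    simpa using this
  have hX1 := maxVal_pos hX ⟨v, hv⟩
  have hC : 0 < k.CC := by
    have := k.UN; have := k.U_pos
    have : 0 < W * k.N := Nat.mul_pos k.hW (by omega)
    unfold Cst.CC; omega
  refine ⟨fun x => if x = v then 0 else f x,
    fun a b => (a = v ∧ G.Adj v b) ∨ (a ≠ v ∧ b ≠ v ∧ R a b), ?_, ?_, ?_⟩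
  · intro x hx
    by_cases hxv : x = v
    · simp only [hxv, if_true]; positivity
    · simp only [hxv, if_false]; exact h1 x (Finset.mem_erase.2 ⟨hxv, hx⟩)
  · intro x hx
    by_cases hxv : x = v
    · subst hxv
      have : (A.filter (fun u => (x = x ∧ G.Adj x u) ∨ (x ≠ x ∧ u ≠ x ∧ R x u))) = nb G x A := by
        ext u; simp [mem_nb]
      refine le_trans (Finset.card_le_card (t := nb G x A) (fun u hu => ?_)) ?_
      · rw [← this]
        simpa only [Finset.mem_filter] using hu
      calc _ ≤ k.d0 := hd
        _ ≤ k.e := by unfold Cst.e; omega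
        _ ≤ k.e * w := Nat.le_mul_of_pos_right _ hw1
    · refine le_trans (Finset.card_le_card ?_) (h2 x (Finset.mem_erase.2 ⟨hxv, hx⟩))
      intro u hu
      simp only [Finset.mem_filter, hxv, false_and, false_or] at hu
      simp only [Finset.mem_filter, Finset.mem_erase]
      tauto
  · intro a ha b hb hab hf
    by_cases hav : a = v
    · subst hav; left; left; exact ⟨rfl, hab⟩
    · by_cases hbv : b = v
      · subst hbv; right; left; exact ⟨rfl, hab.symm⟩
      · simp only [hav, hbv, if_false] at hf
        rcases h3 a (Finset.mem_erase.2 ⟨hav, ha⟩) b (Finset.mem_erase.2 ⟨hbv, hb⟩) hab hf with h | h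
        · left; right; exact ⟨hav, hbv, h⟩
        · right; right; exact ⟨hbv, hav, h⟩

/-- Special vertices. -/
noncomputable def SS (k : Cst s W) (G : SimpleGraph V) (A : Finset V) {ι : Type} [Fintype ι]
    (L : ι → Finset V) : Finset V := UL L ∪ Pend s G A L ∪ QQ k G A L

/-- Typical vertices. -/
noncomputable def TT (k : Cst s W) (G : SimpleGraph V) (A : Finset V) {ι : Type} [Fintype ι]
    (L : ι → Finset V) : Finset V := YY k G A L \ SS k G A L

lemma mem_TT {y : V} (hy : y ∈ TT k G A L) : y ∈ A ∧ y ∈ YY k G A L ∧ y ∉ UL L ∧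
    y ∉ Pend s G A L ∧ y ∉ QQ k G A L ∧ KK k G L y ≠ ∅ ∧ ∃ u ∈ UL L, G.Adj y u := by
  simp only [TT, SS, Finset.mem_sdiff, Finset.mem_union, not_or] at hy
  have := Finset.mem_filter.1 hy.1
  refine ⟨this.1, hy.1, hy.2.1.1, hy.2.1.2, hy.2.2, ?_⟩
  rcases this.2 with h | h
  · exact (hy.2.1.1 h).elim
  · exact h

lemma Ctx.cardSS (h : Ctx k G A L0 L) : (SS k G A L).card ≤ k.B0 := by
  have h1 := Finset.card_union_le (UL L ∪ Pend s G A L) (QQ k G A L)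
  have h2 := Finset.card_union_le (UL L) (Pend s G A L)
  have h3 := h.cardUL
  have h4 := h.cardPend
  have h5 := h.cardQ
  unfold SS Cst.B0
  omega

/-- Palette sizes. -/
def pal (k : Cst s W) (w : ℕ) (L : ι → Finset V) (i : ι) : ℕ :=
  k.N + k.CC * w * (w-1)^2 * ((L i).card + k.U)

lemma Ctx.part (h : Ctx k G A L0 L) {w : ℕ} (hw : CliqueLe G A w) (hwW : w ≤ W)
    (ih : ∀ B, B ⊂ A → ∀ w' X', w' ≤ W → CliqueLe G B w' → MaxVal k G B X' → Col k G B w' X')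
    (K : Finset ι) :
    ∃ f : V → (Σ _ : ι, ℕ), ∃ R : V → V → Prop,
      (∀ v ∈ TT k G A L, KK k G L v = K → f v ∈ K.sigma (fun i => Finset.range (pal k w L i))) ∧
      (∀ v ∈ TT k G A L, KK k G L v = K →
        (((TT k G A L).filter (fun y => KK k G L y = K)).filter (fun u => R v u)).card
          ≤ k.e * (w-1)) ∧
      (∀ u ∈ TT k G A L, KK k G L u = K → ∀ v ∈ TT k G A L, KK k G L v = K →
        G.Adj u v → f u = f v → R u v ∨ R v u) := by
  have hne : Nonempty ι := Fintype.card_pos_iff.1 (by have := h.two; omega)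
  obtain ⟨i1⟩ := hne
  have hneS : Nonempty (Σ _ : ι, ℕ) := ⟨⟨i1, 0⟩⟩
  set M := (TT k G A L).filter (fun y => KK k G L y = K) with hM
  have hMA : M ⊆ A := fun y hy => (mem_TT (Finset.mem_filter.1 hy).1).1
  have hMU : ∀ y ∈ M, y ∉ UL L := fun y hy => (mem_TT (Finset.mem_filter.1 hy).1).2.2.1
  by_cases hMe : M.Nonempty
  swap
  · have : ∀ v ∈ TT k G A L, KK k G L v ≠ K := by
      intro v hv hK
      exact hMe ⟨v, Finset.mem_filter.2 ⟨hv, hK⟩⟩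
    exact ⟨fun _ => ⟨i1, 0⟩, fun _ _ => False, fun v hv hK => (this v hv hK).elim,
      fun v hv hK => (this v hv hK).elim, fun v hv hK => (this v hv hK).elim⟩
  obtain ⟨y0, hy0⟩ := hMe
  obtain ⟨hy0T, hy0K⟩ := Finset.mem_filter.1 hy0
  obtain ⟨yA, yY, yU, yP, yQ, yK, yn⟩ := mem_TT hy0T
  obtain ⟨l, hl⟩ := h.type_ne_univ yA yU yP yQ yn
  rw [hy0K] at hl yK
  obtain ⟨i0, hi0⟩ := Finset.nonempty_iff_ne_empty.2 yK
  by_cases hsmall : M.card < k.N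
  · obtain ⟨g, hg1, hg2⟩ := enc_exists M
    refine ⟨fun v => ⟨i0, g v⟩, fun _ _ => False, ?_, ?_, ?_⟩
    · intro v hv hK
      have := hg1 v (Finset.mem_filter.2 ⟨hv, hK⟩)
      rw [Finset.mem_sigma]
      refine ⟨hi0, ?_⟩
      rw [Finset.mem_range]
      unfold pal
      show g v < _
      omega
    · intro v _ _; simp
    · intro u hu huK v hv hvK huv hf
      have e : g u = g v := by simpa using hf
      have := hg2 u (Finset.mem_filter.2 ⟨hu, huK⟩) v (Finset.mem_filter.2 ⟨hv, hvK⟩) e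
      exact (huv.ne this).elim
  · push Not at hsmall
    have hw' : CliqueLe G M (w-1) := by
      intro K' hK' hc
      have := h.clique_drop hw (l := l) hMA (fun y hy => by
        rw [(Finset.mem_filter.1 hy).2]; exact hl) hK' hc
      omega
    have hmax := combine h.templ h.cl h.max Kᶜ L (fun _ => le_rfl) (fun i _ => by omega) hMA
      (h.disj_of hMU) (by
        intro v hv i hi
        have e := (Finset.mem_filter.1 hv).2
        rw [← e, Finset.mem_compl, mem_KK] at hi
        omega)
    rw [compl_compl] at hmax
    set x := ∑ i ∈ K, ((L i).card + k.U) with hx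
    have hge := maxVal_ge hmax hsmall
    have hWz : W * k.z ≤ x := by
      have := k.hzN
      have e : (W + 1) * k.z = W * k.z + k.z := by ring
      omega
    have hss : M ⊂ A := by
      refine Finset.ssubset_iff_subset_ne.2 ⟨hMA, fun e => ?_⟩
      have hb := h.templ.big i1
      obtain ⟨u, hu⟩ : (L i1).Nonempty := by
        rw [← Finset.card_pos]; have := k.U_pos; omega
      exact hMU u (by rw [e]; exact h.templ.sub i1 hu) (L_sub_UL i1 hu)
    obtain ⟨f, R, h1, h2, h3⟩ := ih M hss (w-1) (k.z + x) (by omega) hw' hmax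
    have hcard : k.CC * (w-1)^3 * (k.z + x) ≤
        (K.sigma (fun i => Finset.range (pal k w L i))).card := by
      rw [Finset.card_sigma]
      simp only [Finset.card_range, pal]
      rw [Finset.sum_add_distrib, ← Finset.mul_sum, ← hx]
      have e1 : (w-1) * (k.z + x) ≤ w * x := by
        rcases Nat.eq_zero_or_pos w with h0 | h0
        · simp [h0]
        · obtain ⟨m, rfl⟩ : ∃ m, w = m + 1 := ⟨w-1, by omega⟩
          have : m * k.z ≤ W * k.z := Nat.mul_le_mul_right _ (by omega)
          simp only [Nat.add_sub_cancel]
          nlinarith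
      have e2 := Nat.mul_le_mul_left (k.CC * (w-1)^2) e1
      calc _ = k.CC * (w-1)^2 * ((w-1) * (k.z + x)) := by ring
        _ ≤ _ := e2
        _ = k.CC * w * (w-1)^2 * x := by ring
        _ ≤ _ := Nat.le_add_left _ _
    obtain ⟨g, hg1, hg2⟩ := dec_exists _ hcard
    refine ⟨fun v => g (f v), R, ?_, ?_, ?_⟩
    · exact fun v hv hK => hg1 _ (h1 v (Finset.mem_filter.2 ⟨hv, hK⟩))
    · exact fun v hv hK => h2 v (Finset.mem_filter.2 ⟨hv, hK⟩)
    · intro u hu huK v hv hvK huv hf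
      have hu' : u ∈ M := Finset.mem_filter.2 ⟨hu, huK⟩
      have hv' : v ∈ M := Finset.mem_filter.2 ⟨hv, hvK⟩
      exact h3 u hu' v hv' huv (hg2 _ (h1 u hu') _ (h1 v hv') hf)

/-- The bad relation. -/
def Bad (k : Cst s W) (G : SimpleGraph V) (A : Finset V) {ι : Type} [Fintype ι]
    (L : ι → Finset V) (y x : V) : Prop :=
  y ∈ TT k G A L ∧ x ∈ TT k G A L ∧ G.Adj y x ∧ ∃ l m, l ∉ KK k G L y ∧ m ∈ KK k G L y ∧
    nb G x (L l) = ∅ ∧ nb G x (L m) = ∅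

lemma Ctx.cardBad (h : Ctx k G A L0 L) (y : V) :
    (A.filter (fun x => Bad k G A L y x)).card ≤ W^2 * k.q := by
  let F : ι × ι → Finset V := fun t => A.filter (fun x => y ∈ TT k G A L ∧ x ∈ TT k G A L ∧
    G.Adj y x ∧ t.1 ∉ KK k G L y ∧ t.2 ∈ KK k G L y ∧ nb G x (L t.1) = ∅ ∧ nb G x (L t.2) = ∅)
  have hcov : A.filter (fun x => Bad k G A L y x) ⊆
      (Finset.univ : Finset (ι × ι)).biUnion F := by
    intro x hx
    obtain ⟨hxA, h1, h2, h3, l, m, h4⟩ := Finset.mem_filter.1 hx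
    exact Finset.mem_biUnion.2 ⟨(l, m), Finset.mem_univ _, Finset.mem_filter.2
      ⟨hxA, h1, h2, h3, h4⟩⟩
  have hc : ((Finset.univ : Finset (ι × ι)).biUnion F).card ≤
      (Finset.univ : Finset (ι × ι)).card * k.q := by
    apply Finset.card_biUnion_le_card_mul
    rintro ⟨l, m⟩ -
    by_cases hne : (F (l, m)).Nonempty
    · obtain ⟨x0, hx0⟩ := hne
      obtain ⟨-, h1, -, -, h4, h5, -⟩ := Finset.mem_filter.1 hx0
      refine (h.badLemma (mem_TT h1).2.2.1 h4 h5 (Finset.filter_subset _ _) ?_ ?_ ?_ ?_).le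
      · exact fun x hx => (mem_TT (Finset.mem_filter.1 hx).2.2.1).2.2.1
      · exact fun x hx => (Finset.mem_filter.1 hx).2.2.2.1
      · exact fun x hx => (Finset.mem_filter.1 hx).2.2.2.2.2.2.1
      · exact fun x hx => (Finset.mem_filter.1 hx).2.2.2.2.2.2.2
    · rw [Finset.not_nonempty_iff_eq_empty.1 hne]; simp
  refine ((Finset.card_le_card hcov).trans hc).trans (Nat.mul_le_mul_right _ ?_)
  rw [Finset.card_univ, Fintype.card_prod, sq]
  exact Nat.mul_le_mul (h.templ.cardι h.cl) (h.templ.cardι h.cl)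

lemma Ctx.bad_of (h : Ctx k G A L0 L) {y x : V} {i l : ι} (hy : y ∈ TT k G A L)
    (hx : x ∈ TT k G A L) (hyx : G.Adj y x) (hiy : i ∈ KK k G L y) (hix : i ∈ KK k G L x)
    (hlx : l ∈ KK k G L x) (hly : l ∉ KK k G L y) : Bad k G A L y x := by
  obtain ⟨xA, xY, xU, xP, xQ, xK, xn⟩ := mem_TT hx
  have hil : i ≠ l := fun e => hly (e ▸ hiy)
  have h2 : 2 ≤ (KK k G L x).card := Finset.one_lt_card.2 ⟨i, hix, l, hlx, hil⟩
  have ht := h.typeLemma xA xU xP xQ h2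
  exact ⟨hy, hx, hyx, l, i, hly, hiy, ht l hlx, ht i hix⟩

lemma Ctx.step (h : Ctx k G A L0 L) {w X : ℕ} (hw : CliqueLe G A w) (hwW : w ≤ W)
    (hX : MaxVal k G A X)
    (ih : ∀ B, B ⊂ A → ∀ w' X', w' ≤ W → CliqueLe G B w' → MaxVal k G B X' → Col k G B w' X') :
    Col k G A w X := by
  have hne : Nonempty ι := Fintype.card_pos_iff.1 (by have := h.two; omega)
  obtain ⟨i1⟩ := hne
  obtain ⟨u1, hu1⟩ : (L i1).Nonempty := by
    rw [← Finset.card_pos]; have := k.U_pos; have := h.templ.big i1; omega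
  have hu1A := h.templ.sub i1 hu1
  have hu1Y : u1 ∈ YY k G A L := Finset.mem_filter.2 ⟨hu1A, Or.inl (L_sub_UL i1 hu1)⟩
  have hw1 : 1 ≤ w := by
    have := hw {u1} (by simpa using hu1A) (by simp)
    simpa using this
  have hX1 := maxVal_pos hX ⟨u1, hu1A⟩
  have hYA : YY k G A L ⊆ A := Finset.filter_subset _ _
  have hss : A \ YY k G A L ⊂ A := by
    refine Finset.ssubset_iff_subset_ne.2 ⟨Finset.sdiff_subset, fun e => ?_⟩
    rw [← e] at hu1A
    exact (Finset.mem_sdiff.1 hu1A).2 hu1Y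
  obtain ⟨f0, R0, c1, c2, c3⟩ := ih _ hss w X hwW (hw.mono Finset.sdiff_subset)
    (hX.mono Finset.sdiff_subset)
  choose fK RK p1 p2 p3 using fun K => h.part hw hwW ih K
  let P : Finset (V ⊕ (Σ _ : ι, ℕ)) := (SS k G A L).disjSum
    ((Finset.univ : Finset ι).sigma (fun i => Finset.range (pal k w L i)))
  obtain ⟨g, hg1, hg2⟩ := enc_exists P
  have hPc : P.card ≤ k.CC * w^3 * X := by
    have e1 := h.cardSS
    have e2 := hX _ _ _ h.templ
    have e3 := h.templ.cardι h.cl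
    simp only [P, Finset.card_disjSum, Finset.card_sigma, Finset.card_range, pal]
    rw [Finset.sum_add_distrib, ← Finset.mul_sum, Finset.sum_const, Finset.card_univ, smul_eq_mul]
    have e4 : ∑ i, ((L i).card + k.U) ≤ X := by unfold val at e2; omega
    have e5 := Nat.mul_le_mul_left (k.CC * w * (w-1)^2) e4
    have e6 := Nat.mul_le_mul_right k.N e3
    have e7 : k.CC + k.CC * w * (w-1)^2 * X ≤ k.CC * w^3 * X := by
      obtain ⟨m, rfl⟩ : ∃ m, w = m + 1 := ⟨w-1, by omega⟩
      obtain ⟨x, rfl⟩ : ∃ x, X = x + 1 := ⟨X-1, by omega⟩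
      simp only [Nat.add_sub_cancel]
      have : 1 + (m+1) * m^2 * (x+1) ≤ (m+1)^3 * (x+1) := by
        have e : (m+1)^3 * (x+1) = 1 + (m+1) * m^2 * (x+1) + (x + (2*m^2 + 3 * m) * (x+1)) := by
          ring
        omega
      calc _ = k.CC * (1 + (m+1) * m^2 * (x+1)) := by ring
        _ ≤ k.CC * ((m+1)^3 * (x+1)) := Nat.mul_le_mul_left _ this
        _ = _ := by ring
    have e8 : k.CC = k.B0 + W * k.N := rfl
    omega
  let fY : V → V ⊕ (Σ _ : ι, ℕ) := fun v =>
    if v ∈ SS k G A L then Sum.inl v else Sum.inr (fK (KK k G L v) v)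
  have hTT : ∀ v ∈ YY k G A L, v ∉ SS k G A L → v ∈ TT k G A L := fun v hv hv' =>
    Finset.mem_sdiff.2 ⟨hv, hv'⟩
  have hfYP : ∀ v ∈ YY k G A L, fY v ∈ P := by
    intro v hv
    by_cases hS : v ∈ SS k G A L
    · simp only [fY, hS, if_true, P, Finset.inl_mem_disjSum]
    · simp only [fY, hS, if_false, P, Finset.inr_mem_disjSum]
      have := p1 (KK k G L v) v (hTT v hv hS) rfl
      rw [Finset.mem_sigma] at this ⊢
      exact ⟨Finset.mem_univ _, this.2⟩
  refine ⟨fun v => if v ∈ YY k G A L then g (fY v) else f0 v,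
    fun v u => (v ∈ YY k G A L ∧ u ∉ YY k G A L ∧ G.Adj v u) ∨
      (v ∉ YY k G A L ∧ u ∉ YY k G A L ∧ R0 v u) ∨
      (v ∈ TT k G A L ∧ u ∈ TT k G A L ∧ KK k G L u = KK k G L v ∧ RK (KK k G L v) v u) ∨
      Bad k G A L v u, ?_, ?_, ?_⟩
  · intro v hv
    by_cases hvY : v ∈ YY k G A L
    · simp only [hvY, if_true]
      exact lt_of_lt_of_le (hg1 _ (hfYP v hvY)) hPc
    · simp only [hvY, if_false]
      exact c1 v (Finset.mem_sdiff.2 ⟨hv, hvY⟩)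
  · intro v hv
    by_cases hvY : v ∈ YY k G A L
    · have hcov : (A.filter (fun u => (v ∈ YY k G A L ∧ u ∉ YY k G A L ∧ G.Adj v u) ∨
          (v ∉ YY k G A L ∧ u ∉ YY k G A L ∧ R0 v u) ∨
          (v ∈ TT k G A L ∧ u ∈ TT k G A L ∧ KK k G L u = KK k G L v ∧ RK (KK k G L v) v u) ∨
          Bad k G A L v u)) ⊆ (A \ YY k G A L).filter (fun x => G.Adj v x) ∪
          (A.filter (fun u => v ∈ TT k G A L ∧ u ∈ TT k G A L ∧ KK k G L u = KK k G L v ∧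
            RK (KK k G L v) v u) ∪ A.filter (fun x => Bad k G A L v x)) := by
        intro u hu
        simp only [Finset.mem_filter, Finset.mem_union, Finset.mem_sdiff] at hu ⊢
        tauto
      have e1 := card_le_add_of_cover hcov
      have e2 := Finset.card_union_le (A.filter (fun u => v ∈ TT k G A L ∧ u ∈ TT k G A L ∧
        KK k G L u = KK k G L v ∧ RK (KK k G L v) v u)) (A.filter (fun x => Bad k G A L v x))
      have e3 := h.out hvY
      have e4 := h.cardBad v
      have e5 : (A.filter (fun u => v ∈ TT k G A L ∧ u ∈ TT k G A L ∧
          KK k G L u = KK k G L v ∧ RK (KK k G L v) v u)).card ≤ k.e * (w-1) := by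
        by_cases hvT : v ∈ TT k G A L
        · refine le_trans (Finset.card_le_card ?_) (p2 (KK k G L v) v hvT rfl)
          intro u hu
          simp only [Finset.mem_filter] at hu ⊢
          tauto
        · simp [hvT]
      have e6 : k.e * w = k.e * (w-1) + k.e := by
        obtain ⟨m, rfl⟩ : ∃ m, w = m + 1 := ⟨w-1, by omega⟩
        simp only [Nat.add_sub_cancel]; ring
      have e7 : k.e = k.d0 + (k.q + k.N) + W^2 * k.q := rfl
      refine le_trans (Finset.card_le_card (fun u hu => ?_)) (e1.trans ?_)
      · simpa only [Finset.mem_filter] using hu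
      omega
    · refine le_trans (Finset.card_le_card ?_) (c2 v (Finset.mem_sdiff.2 ⟨hv, hvY⟩))
      intro u hu
      have hvT : v ∉ TT k G A L := fun hh => hvY (mem_TT hh).2.1
      simp only [Finset.mem_filter, hvY, hvT, Bad, false_and, false_or, or_false,
        not_false_eq_true, true_and] at hu
      simp only [Finset.mem_filter, Finset.mem_sdiff]
      tauto
  · intro u hu v hv huv hf
    by_cases huY : u ∈ YY k G A L
    · by_cases hvY : v ∈ YY k G A L
      · simp only [huY, hvY, if_true] at hf
        have hf' := hg2 _ (hfYP u huY) _ (hfYP v hvY) hf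
        by_cases huS : u ∈ SS k G A L
        · by_cases hvS : v ∈ SS k G A L
          · simp only [fY, huS, hvS, if_true] at hf'
            exact (huv.ne (Sum.inl.inj hf')).elim
          · simp [fY, huS, hvS] at hf'
        · by_cases hvS : v ∈ SS k G A L
          · simp [fY, huS, hvS] at hf'
          · simp only [fY, huS, hvS, if_false] at hf'
            have hf2 := Sum.inr.inj hf'
            have huT := hTT u huY huS
            have hvT := hTT v hvY hvS
            by_cases hKe : KK k G L u = KK k G L v
            · rw [hKe] at hf2
              rcases p3 (KK k G L v) u huT hKe v hvT rfl huv hf2 with h1 | h1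
              · left; right; right; left; exact ⟨huT, hvT, hKe.symm, by rw [hKe]; exact h1⟩
              · right; right; right; left; exact ⟨hvT, huT, hKe, h1⟩
            · have m1 := (Finset.mem_sigma.1 (p1 (KK k G L u) u huT rfl)).1
              have m2 := (Finset.mem_sigma.1 (p1 (KK k G L v) v hvT rfl)).1
              rw [← hf2] at m2
              by_cases hsub : KK k G L v ⊆ KK k G L u
              · have : ¬ KK k G L u ⊆ KK k G L v := fun hh => hKe (hh.antisymm hsub)
                obtain ⟨l, hl1, hl2⟩ := Finset.not_subset.1 this
                right; right; right; right
                exact h.bad_of hvT huT huv.symm m2 m1 hl1 hl2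
              · obtain ⟨l, hl1, hl2⟩ := Finset.not_subset.1 hsub
                left; right; right; right
                exact h.bad_of huT hvT huv m1 m2 hl1 hl2
      · left; left; exact ⟨huY, hvY, huv⟩
    · by_cases hvY : v ∈ YY k G A L
      · right; left; exact ⟨hvY, huY, huv.symm⟩
      · simp only [huY, hvY, if_false] at hf
        rcases c3 u (Finset.mem_sdiff.2 ⟨hu, huY⟩) v (Finset.mem_sdiff.2 ⟨hv, hvY⟩) huv hf with h1 | h1
        · left; right; left; exact ⟨huY, hvY, h1⟩
        · right; right; left; exact ⟨hvY, huY, h1⟩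

theorem main_col (k : Cst s W) (hG : IsInducedFree G (doubleStarGraph s)) (A : Finset V) :
    CliqueLe G A W → ∀ w X, w ≤ W → CliqueLe G A w → MaxVal k G A X → Col k G A w X := by
  induction A using Finset.strongInduction with
  | H A ih =>
    intro hA w X hwW hw hX
    by_cases hne : A.Nonempty
    swap
    · rw [Finset.not_nonempty_iff_eq_empty.1 hne]
      exact ⟨fun _ => 0, fun _ _ => False, by simp, by simp, by simp⟩
    by_cases hlow : ∃ v ∈ A, (nb G v A).card ≤ k.d0
    · obtain ⟨v, hv, hd⟩ := hlow
      have hsub : A.erase v ⊆ A := Finset.erase_subset _ _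
      exact col_low hw hX hv hd (ih _ (Finset.erase_ssubset hv) (hA.mono hsub) w X hwW
        (hw.mono hsub) (hX.mono hsub))
    · push Not at hlow
      obtain ⟨ι, _, L0, L, hT, hmax, h2⟩ := exists_opt hG hA hne hlow
      exact Ctx.step ⟨hG, hA, hT, hmax, h2⟩ hw hwW hX
        (fun B hB w' X' hw' hc hX' => ih B hB (hA.mono hB.1) w' X' hw' hc hX')
end DStar


namespace DStar
open scoped Classical
variable {V : Type} {G : SimpleGraph V} {s W : ℕ}

/-- A finite relation with out-degrees at most `E` has a proper colouring with `2E+1` colours. -/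
lemma orient_col (R : V → V → Prop) (E : ℕ) (A : Finset V) :
    (∀ v ∈ A, (A.filter (fun u => R v u)).card ≤ E) →
    ∃ g : V → ℕ, (∀ v ∈ A, g v < 2 * E + 1) ∧
      ∀ u ∈ A, ∀ v ∈ A, u ≠ v → (R u v ∨ R v u) → g u ≠ g v := by
  induction A using Finset.strongInduction with
  | H A ih =>
    intro hE
    by_cases hne : A.Nonempty
    swap
    · rw [Finset.not_nonempty_iff_eq_empty.1 hne]
      exact ⟨fun _ => 0, by simp, by simp⟩
    have hdc : ∑ v ∈ A, (A.filter (fun u => R v u)).card =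
        ∑ v ∈ A, (A.filter (fun u => R u v)).card :=
      Finset.sum_card_bipartiteAbove_eq_sum_card_bipartiteBelow (s := A) (t := A) R
    have hsum : ∑ v ∈ A, (A.filter (fun u => R v u)).card ≤ ∑ v ∈ A, E :=
      Finset.sum_le_sum hE
    rw [hdc] at hsum
    obtain ⟨v, hv, hvE⟩ := Finset.exists_le_of_sum_le hne hsum
    obtain ⟨g, hg1, hg2⟩ := ih (A.erase v) (Finset.erase_ssubset hv) (by
      intro x hx
      refine le_trans (Finset.card_le_card ?_) (hE x (Finset.mem_of_mem_erase hx))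
      exact Finset.filter_subset_filter _ (Finset.erase_subset _ _))
    set F := A.filter (fun u => R v u) ∪ A.filter (fun u => R u v) with hF
    have hFc : F.card ≤ 2 * E := by
      have := Finset.card_union_le (A.filter (fun u => R v u)) (A.filter (fun u => R u v))
      have := hE v hv
      simp only [hF]
      omega
    obtain ⟨c, hc1, hc2⟩ : ∃ c ∈ Finset.range (2*E+1), c ∉ F.image g := by
      by_contra hcon
      push Not at hcon
      have h1 := Finset.card_le_card (show Finset.range (2*E+1) ⊆ F.image g from hcon)
      have h2 := Finset.card_image_le (s := F) (f := g)
      rw [Finset.card_range] at h1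
      omega
    have hfree : ∀ u ∈ A, (R u v ∨ R v u) → g u ≠ c := by
      intro u hu hR hh
      apply hc2
      refine Finset.mem_image.2 ⟨u, ?_, hh⟩
      simp only [hF, Finset.mem_union, Finset.mem_filter]
      tauto
    refine ⟨fun x => if x = v then c else g x, ?_, ?_⟩
    · intro x hx
      by_cases hxv : x = v
      · simp only [hxv, if_true]; exact Finset.mem_range.1 hc1
      · simp only [hxv, if_false]; exact hg1 x (Finset.mem_erase.2 ⟨hxv, hx⟩)
    · intro x hx y hy hxy hR
      by_cases hxv : x = v
      · have hyv : y ≠ v := fun h => hxy (hxv.trans h.symm)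
        subst hxv
        simp only [if_true, hyv, if_false]
        exact (hfree y hy hR.symm).symm
      · by_cases hyv : y = v
        · subst hyv
          simp only [if_true, hxv, if_false]
          exact hfree x hx hR
        · simp only [hxv, hyv, if_false]
          exact hg2 x (Finset.mem_erase.2 ⟨hxv, hx⟩) y (Finset.mem_erase.2 ⟨hyv, hy⟩) hxy hR

/-- polynomially bounded -/
def PB (f : ℕ → ℕ) : Prop := ∃ d, ∀ W, 2 ≤ W → f W ≤ W ^ d

lemma PB.const (c : ℕ) : PB (fun _ => c) :=
  ⟨c, fun W hW => (Nat.lt_two_pow_self).le.trans (Nat.pow_le_pow_left hW c)⟩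
lemma PB.id : PB (fun W => W) := ⟨1, fun W _ => by simp⟩
lemma PB.mul {f g : ℕ → ℕ} (hf : PB f) (hg : PB g) : PB (fun W => f W * g W) := by
  obtain ⟨d, hd⟩ := hf
  obtain ⟨e, he⟩ := hg
  exact ⟨d + e, fun W hW => by rw [pow_add]; exact Nat.mul_le_mul (hd W hW) (he W hW)⟩
lemma PB.add {f g : ℕ → ℕ} (hf : PB f) (hg : PB g) : PB (fun W => f W + g W) := by
  obtain ⟨d, hd⟩ := hf
  obtain ⟨e, he⟩ := hg
  refine ⟨d + e + 1, fun W hW => ?_⟩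
  have h1 : W ^ d ≤ W ^ (d+e) := Nat.pow_le_pow_right (by omega) (by omega)
  have h2 : W ^ e ≤ W ^ (d+e) := Nat.pow_le_pow_right (by omega) (by omega)
  have h3 := hd W hW
  have h4 := he W hW
  have h5 := Nat.mul_le_mul_left (W ^ (d+e)) hW
  rw [pow_succ]
  show f W + g W ≤ _
  omega
lemma PB.pow {f : ℕ → ℕ} (hf : PB f) (n : ℕ) : PB (fun W => f W ^ n) := by
  obtain ⟨d, hd⟩ := hf
  exact ⟨d * n, fun W hW => by rw [pow_mul]; exact Nat.pow_le_pow_left (hd W hW) n⟩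

/-- The constants. -/
def mkC (s W : ℕ) (hW : 2 ≤ W) : Cst s W where
  q := (W+1)^s
  b1 := 20 * W^3 * (W+1)^s
  b := 2 * (20 * W^3 * (W+1)^s)
  a := 3000 * W^7 * (W+1)^s
  c := 10000 * W^7 * (W+1)^s
  U := 30000 * W^8 * (W+1)^s
  lam := 10 * (30000 * W^8 * (W+1)^s) * W
  N := 20 * (30000 * W^8 * (W+1)^s) * W^3
  z := 10 * (30000 * W^8 * (W+1)^s) * W * W + 5 * W * (30000 * W^8 * (W+1)^s)
  hW := by omega
  hq := rfl
  hqb := Nat.le_mul_of_pos_left _ (by positivity)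
  hb := rfl
  hba := by
    have h : W^3 ≤ W^7 := Nat.pow_le_pow_right (by omega) (by omega)
    have := Nat.mul_le_mul_right ((W+1)^s) h
    rw [mul_assoc 20, mul_assoc 3000]
    omega
  hNb := by
    have : 0 ≤ W^14 * ((W+1)^s)^2 := Nat.zero_le _
    nlinarith
  hloss := by
    have h1 : W^7 ≤ W^8 := Nat.pow_le_pow_right (by omega) (by omega)
    have h2 : W^4 ≤ W^8 := Nat.pow_le_pow_right (by omega) (by omega)
    have h1' := Nat.mul_le_mul_right ((W+1)^s) h1
    have h2' := Nat.mul_le_mul_right ((W+1)^s) h2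
    ring_nf at h1' h2' ⊢
    omega
  hWa := by
    have h1 : W^7 ≤ W^8 := Nat.pow_le_pow_right (by omega) (by omega)
    have h1' := Nat.mul_le_mul_right ((W+1)^s) h1
    have h3 : 0 < W^8 * (W+1)^s := by positivity
    have e : (W+1) * (3000 * W^7 * (W+1)^s) =
      3000 * (W^8 * (W+1)^s) + 3000 * (W^7 * (W+1)^s) := by ring
    rw [e, mul_assoc]
    omega
  h10 := by
    have h1 : W^7 ≤ W^8 := Nat.pow_le_pow_right (by omega) (by omega)
    have h1' := Nat.mul_le_mul_right ((W+1)^s) h1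
    nlinarith
  hac := by
    have h1 : W^7 ≤ W^8 := Nat.pow_le_pow_right (by omega) (by omega)
    have h1' := Nat.mul_le_mul_right ((W+1)^s) h1
    have h3 : 0 < W^8 * (W+1)^s := by positivity
    nlinarith
  hNq := le_of_eq (by ring)
  hz := rfl
  hlam := rfl
  hzN := by
    generalize 30000 * W^8 * (W+1)^s = U
    have h : 15 * W^2 + 5 * W ≤ 10 * W^3 := by
      have h2 : 2 * W ≤ W^2 := by nlinarith
      have h3 : 2 * W^2 ≤ W^3 := by nlinarith
      omega
    have := Nat.mul_le_mul_left U h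
    nlinarith

/-- number of colours -/
def nColN (q U lam N s W : ℕ) : ℕ :=
  ((W * N + (W * N)^(s+2) * q + W * (W * N)^2 * N) + W * N) * W^3 * (W * (N + U + lam)) *
    (2 * ((W * (N^s * q + N) + (q + N) + W^2 * q) * W) + 1)

lemma nCol_PB (s : ℕ) : PB (fun W => nColN ((W+1)^s) (30000 * W^8 * (W+1)^s)
    (10 * (30000 * W^8 * (W+1)^s) * W) (20 * (30000 * W^8 * (W+1)^s) * W^3) s W) := by
  unfold nColN
  repeat' first
    | exact PB.id
    | exact PB.const _
    | apply PB.add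
    | apply PB.mul
    | apply PB.pow

lemma enc_lt {x y P m : ℕ} (hx : x < P) (hy : y < m) : x * m + y < P * m := by
  have h := Nat.mul_le_mul_right m (Nat.succ_le_of_lt hx)
  rw [Nat.succ_mul] at h
  omega

lemma enc_inj {x y x' y' m : ℕ} (hy : y < m) (hy' : y' < m) (h : x * m + y = x' * m + y') :
    x = x' ∧ y = y' := by
  have h1 : y = y' := by
    have := congrArg (· % m) h
    simpa [Nat.mod_eq_of_lt hy, Nat.mod_eq_of_lt hy'] using this
  subst h1
  exact ⟨Nat.eq_of_mul_eq_mul_right (by omega) (Nat.add_right_cancel h), rfl⟩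

lemma proper_col [Fintype V] (hG : IsInducedFree G (doubleStarGraph s)) (hW : 2 ≤ W)
    (hA : CliqueLe G Finset.univ W) :
    ∃ g : V → ℕ, (∀ v, g v < nColN ((W+1)^s) (30000 * W^8 * (W+1)^s)
    (10 * (30000 * W^8 * (W+1)^s) * W) (20 * (30000 * W^8 * (W+1)^s) * W^3) s W) ∧
      ∀ u v, G.Adj u v → g u ≠ g v := by
  obtain ⟨f, R, h1, h2, h3⟩ := main_col (mkC s W hW) hG Finset.univ hA W (mkC s W hW).X0 le_rfl
    hA (maxVal_X0 hA)
  obtain ⟨g, hg1, hg2⟩ := orient_col R _ _ h2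
  refine ⟨fun v => f v * (2 * ((mkC s W hW).e * W) + 1) + g v, ?_, ?_⟩
  · intro v
    have e1 := h1 v (Finset.mem_univ _)
    have e2 := hg1 v (Finset.mem_univ _)
    have : nColN ((W+1)^s) (30000 * W^8 * (W+1)^s)
      (10 * (30000 * W^8 * (W+1)^s) * W) (20 * (30000 * W^8 * (W+1)^s) * W^3) s W =
      (mkC s W hW).CC * W^3 * (mkC s W hW).X0 * (2 * ((mkC s W hW).e * W) + 1) := rfl
    rw [this]
    exact enc_lt e1 e2
  · intro u v huv hh
    have e1 := hg1 u (Finset.mem_univ _)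
    have e2 := hg1 v (Finset.mem_univ _)
    obtain ⟨hd, hm⟩ := enc_inj e1 e2 hh
    exact hg2 u (Finset.mem_univ _) v (Finset.mem_univ _) huv.ne
      (h3 u (Finset.mem_univ _) v (Finset.mem_univ _) huv hd) hm

lemma finish [Fintype V] {n D : ℕ} (g : V → ℕ) (hg : ∀ v, g v < n)
    (hp : ∀ u v, G.Adj u v → g u ≠ g v) :
    KDColorable G n D ∧ G.chromaticNumber ≤ ((n * (D + 1) : ℕ) : ℕ∞) := by
  constructor
  · refine ⟨fun v => ⟨g v, hg v⟩, fun i H ⟨v, hv⟩ => ⟨v, hv, ?_⟩⟩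
    have : H.neighborSet v = ∅ := by
      ext x
      simp only [SimpleGraph.Subgraph.mem_neighborSet, Set.mem_empty_iff_false, iff_false]
      intro hx
      have hadj : G.Adj v.1 x.1 := H.adj_sub hx
      have e1 : (⟨g v.1, hg v.1⟩ : Fin n) = i := v.2
      have e2 : (⟨g x.1, hg x.1⟩ : Fin n) = i := x.2
      exact hp _ _ hadj (congrArg Fin.val (e1.trans e2.symm))
    rw [this]
    simp
  · have hc : G.Colorable n := ⟨SimpleGraph.Coloring.mk (fun v => (⟨g v, hg v⟩ : Fin n))
      (fun {u v} huv h => hp u v huv (congrArg Fin.val h))⟩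
    refine (hc.chromaticNumber_le).trans ?_
    exact_mod_cast Nat.le_mul_of_pos_right n (Nat.succ_pos D)

end DStar

/-- For every `s ≥ 1` there exists `d ≥ 0` such that every `H_s`-free graph `G` (with at least
one vertex) is `(ω^d, ω^{s+8})`-colourable, and hence has chromatic number at most
`ω^d (ω^{s+8} + 1)`. -/
theorem Hs_free_degenerate_colourable (s : ℕ) (hs : 1 ≤ s) :
    ∃ d : ℕ, ∀ (V : Type) [Fintype V] [Nonempty V] (G : SimpleGraph V),
      IsInducedFree G (doubleStarGraph s) →
      KDColorable G (G.cliqueNum ^ d) (G.cliqueNum ^ (s+8)) ∧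
      G.chromaticNumber ≤ ((G.cliqueNum ^ d * (G.cliqueNum ^ (s+8) + 1) : ℕ) : ℕ∞) := by
  obtain ⟨d, hd⟩ := DStar.nCol_PB s
  refine ⟨d, fun V _ _ G hG => ?_⟩
  have hA : DStar.CliqueLe G Finset.univ G.cliqueNum := fun K _ hK => hK.card_le_cliqueNum
  by_cases hW : 2 ≤ G.cliqueNum
  · obtain ⟨g, hg1, hg2⟩ := DStar.proper_col hG hW hA
    exact DStar.finish g (fun v => lt_of_lt_of_le (hg1 v) (hd _ hW)) hg2
  · have h1 : 1 ≤ G.cliqueNum := by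
      have := hA {Classical.arbitrary V} (Finset.subset_univ _) (by simp)
      simpa using this
    refine DStar.finish (fun _ => 0) (fun v => by positivity) ?_
    intro u v huv
    classical
    have := hA {u, v} (Finset.subset_univ _) (by
      simp [SimpleGraph.isClique_insert, huv])
    rw [Finset.card_pair huv.ne] at this
    omega
end

section
/- Let H be a forest. Then there exists c > 0 such that for every H-free finite simple graph G and every integer t ≥ 0, either G contains the complete bipartite graph K_{t,t} as a (not necessarily induced) subgraph, or G has degeneracy less than t^c, and hence has chromatic number at most t^c. -/
open SimpleGraph Set

open Classical in
/-- A forest has a vertex with at most one neighbour. -/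
lemma exists_low_vertex {W : Type*} [Finite W] [Nonempty W] (K : SimpleGraph W)
    (hK : K.IsAcyclic) : ∃ x, ∀ a b, K.Adj x a → K.Adj x b → a = b := by
  cases nonempty_fintype W
  rcases subsingleton_or_nontrivial W with h | h
  · exact ⟨Classical.arbitrary W, fun a b _ _ => Subsingleton.elim a b⟩
  · obtain ⟨T, hKT, -, hT⟩ := (SimpleGraph.connected_top (V := W)).exists_isTree_le_of_le_of_isAcyclic
      (le_top : K ≤ ⊤) hK
    obtain ⟨x, hx⟩ := hT.exists_vert_degree_one_of_nontrivial
    obtain ⟨u, -, hu⟩ := degree_eq_one_iff_existsUnique_adj.mp hx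
    exact ⟨x, fun a b ha hb => (hu a (hKT ha)).trans (hu b (hKT hb)).symm⟩

open Classical in
/-- Every forest is an induced subgraph of a tree on `0, …, N` in which vertex `k+1` has a
unique smaller neighbour `par k`. -/
lemma forest_embed_aux {W : Type*} [Finite W] (H : SimpleGraph W) (hH : H.IsAcyclic)
    (m : ℕ) : ∀ s : Finset W, s.card = m →
    ∃ (N : ℕ) (par : ℕ → ℕ) (f : W → ℕ), (∀ n, par n ≤ n) ∧ (∀ a ∈ s, f a ≤ N) ∧
      (∀ a ∈ s, ∀ b ∈ s, f a = f b → a = b) ∧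
      (∀ a ∈ s, ∀ b ∈ s, ∀ k, f a = k + 1 → f b ≤ k → (H.Adj a b ↔ f b = par k)) := by
  induction m with
  | zero =>
    intro s hs
    rw [Finset.card_eq_zero] at hs
    subst hs
    exact ⟨0, fun _ => 0, fun _ => 0, by simp⟩
  | succ m ih =>
    intro s hs
    have hne : s.Nonempty := Finset.card_pos.mp (by omega)
    have : Nonempty (s : Set W) := hne.to_subtype
    obtain ⟨⟨x, hxs⟩, hx⟩ := exists_low_vertex (H.induce (s : Set W)) (hH.induce _)
    replace hxs : x ∈ s := hxs
    have hx' : ∀ a ∈ s, ∀ b ∈ s, H.Adj x a → H.Adj x b → a = b := by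
      intro a ha b hb h1 h2
      have := hx ⟨a, ha⟩ ⟨b, hb⟩ h1 h2
      simpa using this
    obtain ⟨N, par, f, hp, hfN, hinj, hadj⟩ := ih (s.erase x) (by
      rw [Finset.card_erase_of_mem hxs]; omega)
    by_cases hnb : ∃ p ∈ s, H.Adj x p
    · obtain ⟨p, hps, hxp⟩ := hnb
      have hpx : p ≠ x := hxp.ne'
      have hpe : p ∈ s.erase x := Finset.mem_erase.mpr ⟨hpx, hps⟩
      refine ⟨N + 1, Function.update par N (f p), Function.update f x (N + 1), ?_, ?_, ?_, ?_⟩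
      · intro n
        by_cases hn : n = N
        · subst hn; simpa using hfN p hpe
        · simpa [hn] using hp n
      · intro a ha
        by_cases hax : a = x
        · simp [hax]
        · have := hfN a (Finset.mem_erase.mpr ⟨hax, ha⟩)
          simp [hax]; omega
      · intro a ha b hb hab
        by_cases hax : a = x <;> by_cases hbx : b = x
        · rw [hax, hbx]
        · have := hfN b (Finset.mem_erase.mpr ⟨hbx, hb⟩)
          simp [hax, hbx] at hab; omega
        · have := hfN a (Finset.mem_erase.mpr ⟨hax, ha⟩)
          simp [hax, hbx] at hab; omega
        · simp [hax, hbx] at hab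
          exact hinj a (Finset.mem_erase.mpr ⟨hax, ha⟩) b (Finset.mem_erase.mpr ⟨hbx, hb⟩) hab
      · intro a ha b hb k hk hbk
        by_cases hax : a = x <;> by_cases hbx : b = x
        · subst hax; subst hbx; omega
        · subst hax
          have hbe := Finset.mem_erase.mpr ⟨hbx, hb⟩
          simp [hbx] at hk hbk ⊢
          subst hk
          simp
          constructor
          · intro h; rw [hx' b hb p hps h hxp]
          · intro h; rw [hinj b hbe p hpe h]; exact hxp
        · have := hfN a (Finset.mem_erase.mpr ⟨hax, ha⟩)
          simp [hax, hbx] at hk hbk; omega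
        · have hae := Finset.mem_erase.mpr ⟨hax, ha⟩
          have hbe := Finset.mem_erase.mpr ⟨hbx, hb⟩
          have := hfN a hae
          simp [hax, hbx] at hk hbk ⊢
          have hkN : k ≠ N := by omega
          simp [hkN]
          exact hadj a hae b hbe k hk hbk
    · push Not at hnb
      refine ⟨N + 2, fun n => if n < N then par n else n, Function.update f x (N + 2), ?_, ?_, ?_, ?_⟩
      · intro n
        have := hp n
        dsimp only
        split_ifs <;> omega
      · intro a ha
        by_cases hax : a = x
        · simp [hax]
        · have := hfN a (Finset.mem_erase.mpr ⟨hax, ha⟩)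
          simp [hax]; omega
      · intro a ha b hb hab
        by_cases hax : a = x <;> by_cases hbx : b = x
        · rw [hax, hbx]
        · have := hfN b (Finset.mem_erase.mpr ⟨hbx, hb⟩)
          simp [hax, hbx] at hab; omega
        · have := hfN a (Finset.mem_erase.mpr ⟨hax, ha⟩)
          simp [hax, hbx] at hab; omega
        · simp [hax, hbx] at hab
          exact hinj a (Finset.mem_erase.mpr ⟨hax, ha⟩) b (Finset.mem_erase.mpr ⟨hbx, hb⟩) hab
      · intro a ha b hb k hk hbk
        by_cases hax : a = x <;> by_cases hbx : b = x
        · subst hax; subst hbx; omega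
        · subst hax
          have := hfN b (Finset.mem_erase.mpr ⟨hbx, hb⟩)
          simp [hbx] at hk hbk ⊢
          have hn := hnb b hb
          have hkN : ¬ k < N := by omega
          simp only [hn, hkN, if_false, false_iff]
          omega
        · have := hfN a (Finset.mem_erase.mpr ⟨hax, ha⟩)
          simp [hax, hbx] at hk hbk; omega
        · have hae := Finset.mem_erase.mpr ⟨hax, ha⟩
          have hbe := Finset.mem_erase.mpr ⟨hbx, hb⟩
          have := hfN a hae
          simp [hax, hbx] at hk hbk ⊢
          have hkN : k < N := by omega
          simp only [hkN, if_true]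
          exact hadj a hae b hbe k hk hbk

lemma forest_embed {W : Type*} [Finite W] (H : SimpleGraph W) (hH : H.IsAcyclic) :
    ∃ (N : ℕ) (par : ℕ → ℕ) (f : W → ℕ), (∀ n, par n ≤ n) ∧ (∀ a, f a ≤ N) ∧
      Function.Injective f ∧
      (∀ a b, ∀ k, f a = k + 1 → f b ≤ k → (H.Adj a b ↔ f b = par k)) := by
  cases nonempty_fintype W
  obtain ⟨N, par, f, h1, h2, h3, h4⟩ := forest_embed_aux H hH _ Finset.univ rfl
  exact ⟨N, par, f, h1, fun a => h2 a (Finset.mem_univ _),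
    fun a b h => h3 a (Finset.mem_univ _) b (Finset.mem_univ _) h,
    fun a b => h4 a (Finset.mem_univ _) b (Finset.mem_univ _)⟩

section TreeWalk
open Classical

variable {V : Type*} [Fintype V] (G : SimpleGraph V) (par : ℕ → ℕ)

/-- The (unnormalised) expectation of `f φ` where `φ` is the stationary random walk in `G`
indexed by the tree on `0, …, n` given by `par`. -/
noncomputable def treeE : ℕ → ((ℕ → V) → ℝ) → ℝ
  | 0, f => ∑ v, (G.degree v : ℝ) * f (fun _ => v)
  | n + 1, f => treeE n (fun φ =>
      (∑ z ∈ G.neighborFinset (φ (par n)), f (Function.update φ (n + 1) z)) /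
        (G.degree (φ (par n)) : ℝ))

lemma treeE_mono (n : ℕ) : ∀ f g : (ℕ → V) → ℝ, (∀ φ, f φ ≤ g φ) →
    treeE G par n f ≤ treeE G par n g := by
  induction n with
  | zero =>
    intro f g h
    exact Finset.sum_le_sum fun v _ => mul_le_mul_of_nonneg_left (h _) (Nat.cast_nonneg _)
  | succ n ih =>
    intro f g h
    refine ih _ _ fun φ => ?_
    exact div_le_div_of_nonneg_right (Finset.sum_le_sum fun z _ => h _) (Nat.cast_nonneg _)

lemma treeE_add (n : ℕ) : ∀ f g : (ℕ → V) → ℝ,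
    treeE G par n (fun φ => f φ + g φ) = treeE G par n f + treeE G par n g := by
  induction n with
  | zero =>
    intro f g
    simp only [treeE, mul_add, Finset.sum_add_distrib]
  | succ n ih =>
    intro f g
    simp only [treeE, Finset.sum_add_distrib, add_div]
    exact ih _ _

lemma treeE_mul (n : ℕ) (c : ℝ) : ∀ f : (ℕ → V) → ℝ,
    treeE G par n (fun φ => c * f φ) = c * treeE G par n f := by
  induction n with
  | zero =>
    intro f
    simp only [treeE, Finset.mul_sum]
    exact Finset.sum_congr rfl fun v _ => by ring
  | succ n ih =>
    intro f
    simp only [treeE, ← Finset.mul_sum, mul_div_assoc]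
    exact ih _

lemma treeE_sum {ι : Type*} (n : ℕ) (s : Finset ι) (f : ι → (ℕ → V) → ℝ) :
    treeE G par n (fun φ => ∑ i ∈ s, f i φ) = ∑ i ∈ s, treeE G par n (f i) := by
  induction s using Finset.induction_on with
  | empty =>
    have := treeE_mul G par n 0 (fun _ => 0)
    simpa using this
  | insert a s ha ih =>
    simp only [Finset.sum_insert ha, treeE_add, ih]

/-- Conditioning on the image of the newest leaf. -/
lemma treeE_leaf (n : ℕ) (u : V) (f : (ℕ → V) → ℝ) :
    treeE G par (n + 1) (fun φ => if φ (n + 1) = u then f φ else 0) =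
      ∑ v ∈ G.neighborFinset u, (1 / (G.degree v : ℝ)) *
        treeE G par n (fun φ => if φ (par n) = v then f (Function.update φ (n + 1) u) else 0) := by
  simp only [← treeE_mul, ← treeE_sum]
  rw [treeE]
  congr 1
  funext φ
  simp only [Function.update_self, mul_ite, mul_zero, Finset.sum_ite_eq, mem_neighborFinset]
  rw [Finset.sum_ite_eq' (G.neighborFinset (φ (par n))) u]
  simp only [mem_neighborFinset, G.adj_comm u]
  split_ifs
  · ring
  · simp

lemma treeE_mass (hpar : ∀ n, par n ≤ n) (n : ℕ) : ∀ p ≤ n, ∀ u : V,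
    treeE G par n (fun φ => if φ p = u then 1 else 0) ≤ G.degree u := by
  induction n with
  | zero =>
    intro p hp u
    simp [treeE]
  | succ n ih =>
    intro p hp u
    by_cases h : p = n + 1
    · subst h
      rw [treeE_leaf]
      calc _ ≤ ∑ v ∈ G.neighborFinset u, (1 : ℝ) := by
            refine Finset.sum_le_sum fun v _ => ?_
            calc _ ≤ (1 / (G.degree v : ℝ)) * G.degree v :=
                  mul_le_mul_of_nonneg_left (ih _ (hpar n) v) (by positivity)
              _ ≤ 1 := by rw [one_div]; exact inv_mul_le_one
        _ = _ := by simp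
    · refine le_trans (treeE_mono G par n _ _ fun φ => ?_) (ih p (by omega) u)
      simp only [Function.update_of_ne h]
      rw [Finset.sum_const, card_neighborFinset_eq_degree, nsmul_eq_mul, mul_div_right_comm]
      split_ifs
      · rw [mul_one]; exact div_self_le_one _
      · simp

/-- The part of `S` outside the closed neighbourhood of `u`. -/
noncomputable def outside (S : Finset V) (u : V) : Finset V :=
  S.filter fun z => z ≠ u ∧ ¬ G.Adj u z

/-- The part of `S` outside the closed neighbourhoods of all `φ q`, `q ≤ n`, `q ≠ p`. -/
noncomputable def remain (n p : ℕ) (φ : ℕ → V) (S : Finset V) : Finset V :=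
  S.filter fun z => ∀ q ≤ n, q ≠ p → z ≠ φ q ∧ ¬ G.Adj (φ q) z

lemma few_bad (t : ℕ) (hK : ¬ ContainsKtt G t) (S : Finset V) (hS : 4 * t ≤ S.card) :
    (Finset.univ.filter fun u => (outside G S u).card * (2 * t) < S.card).card ≤ t := by
  by_contra! hcon
  obtain ⟨A, hA, hAt⟩ := Finset.exists_subset_card_eq hcon.le
  apply hK
  have h1 : (A.biUnion fun a => outside G S a).card * (2 * t) ≤ t * S.card := by
    calc _ ≤ (∑ a ∈ A, (outside G S a).card) * (2 * t) :=
          Nat.mul_le_mul_right _ Finset.card_biUnion_le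
      _ = ∑ a ∈ A, (outside G S a).card * (2 * t) := Finset.sum_mul _ _ _
      _ ≤ ∑ a ∈ A, S.card := Finset.sum_le_sum fun a ha => by
          have := hA ha
          simp only [Finset.mem_filter] at this
          exact this.2.le
      _ = t * S.card := by simp [hAt]
  rcases Nat.eq_zero_or_pos t with ht | ht
  · subst ht
    exact ⟨∅, ∅, by simp⟩
  have h2 : (A.biUnion fun a => outside G S a).card * 2 ≤ S.card := by
    by_contra! h
    have : t * S.card < t * ((A.biUnion fun a => outside G S a).card * 2) :=
      Nat.mul_lt_mul_of_pos_left h ht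
    nlinarith
  have h3 : S.card ≤ ((S \ (A.biUnion fun a => outside G S a)) \ A).card
      + A.card + (A.biUnion fun a => outside G S a).card := by
    have e1 := Finset.le_card_sdiff (A.biUnion fun a => outside G S a) S
    have e2 := Finset.le_card_sdiff A (S \ (A.biUnion fun a => outside G S a))
    omega
  obtain ⟨B, hB, hBt⟩ := Finset.exists_subset_card_eq
    (show t ≤ ((S \ (A.biUnion fun a => outside G S a)) \ A).card by omega)
  refine ⟨A, B, hAt, hBt, ?_, ?_⟩
  · rw [Finset.disjoint_left]
    intro a ha hb
    exact (Finset.mem_sdiff.mp (hB hb)).2 ha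
  · intro a ha b hb
    have h := hB hb
    simp only [Finset.mem_sdiff, Finset.mem_biUnion, outside, Finset.mem_filter, not_exists,
      not_and, not_not] at h
    exact h.1.2 a ha h.1.1 (fun e => h.2 (e ▸ ha))

lemma remain_bad (t D : ℕ) (ht : 1 ≤ t) (hD : 1 ≤ D) (hdeg : ∀ v, D ≤ G.degree v)
    (hK : ¬ ContainsKtt G t) (hpar : ∀ n, par n ≤ n) (n : ℕ) :
    ∀ p ≤ n, ∀ (u : V) (S : Finset V), 4 * t * (2 * t) ^ n ≤ S.card →
    treeE G par n (fun φ => if φ p = u then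
      (if (remain G n p φ S).card * (2 * t) ^ n < S.card then 1 else 0) else 0) ≤
      n * ((t : ℝ) / D) * G.degree u := by
  have hDR : (0 : ℝ) < D := by exact_mod_cast hD
  have hDv : ∀ v, (D : ℝ) ≤ G.degree v := fun v => by exact_mod_cast hdeg v
  have hpv : ∀ v, (0 : ℝ) < G.degree v := fun v => hDR.trans_le (hDv v)
  induction n with
  | zero =>
    intro p hp u S hS
    have hp0 : p = 0 := by omega
    subst hp0
    have : ∀ φ : ℕ → V, remain G 0 0 φ S = S := by
      intro φ
      apply Finset.filter_true_of_mem
      intro z _ q hq hq0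
      omega
    simp [this, treeE]
  | succ n ih =>
    intro p hp u S hS
    by_cases h : p = n + 1
    · subst h
      rw [treeE_leaf]
      have key : ∀ v ∈ G.neighborFinset u, (1 / (G.degree v : ℝ)) *
          treeE G par n (fun φ => if φ (par n) = v then
            (if (remain G (n + 1) (n + 1) (Function.update φ (n + 1) u) S).card * (2 * t) ^ (n + 1)
              < S.card then 1 else 0) else 0) ≤
          n * ((t : ℝ) / D) + if (outside G S v).card * (2 * t) < S.card then 1 else 0 := by
        intro v _
        split_ifs with hbad
        · have : (1 / (G.degree v : ℝ)) *
              treeE G par n (fun φ => if φ (par n) = v then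
            (if (remain G (n + 1) (n + 1) (Function.update φ (n + 1) u) S).card * (2 * t) ^ (n + 1)
              < S.card then 1 else 0) else 0) ≤ (1 / (G.degree v : ℝ)) * G.degree v := by
            refine mul_le_mul_of_nonneg_left ?_ (by positivity)
            refine le_trans (treeE_mono G par n _ _ fun φ => ?_)
              (treeE_mass G par hpar n (par n) (hpar n) v)
            split_ifs <;> simp
          rw [one_div_mul_cancel (hpv v).ne'] at this
          have : 0 ≤ n * ((t : ℝ) / D) := by positivity
          linarith
        · push Not at hbad
          have hS' : 4 * t * (2 * t) ^ n ≤ (outside G S v).card := by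
            have : 4 * t * (2 * t) ^ n * (2 * t) ≤ (outside G S v).card * (2 * t) := by
              calc _ = 4 * t * (2 * t) ^ (n + 1) := by ring
                _ ≤ _ := hS.trans hbad
            exact Nat.le_of_mul_le_mul_right this (by omega)
          have := ih (par n) (hpar n) v (outside G S v) hS'
          have h2 : treeE G par n (fun φ => if φ (par n) = v then
            (if (remain G (n + 1) (n + 1) (Function.update φ (n + 1) u) S).card * (2 * t) ^ (n + 1)
              < S.card then 1 else 0) else 0) ≤ n * ((t : ℝ) / D) * G.degree v := by
            refine le_trans (treeE_mono G par n _ _ fun φ => ?_) this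
            by_cases hv : φ (par n) = v
            · simp only [hv, if_true]
              have hrem : remain G (n + 1) (n + 1) (Function.update φ (n + 1) u) S =
                  remain G n (par n) φ (outside G S v) := by
                ext z
                simp only [remain, outside, Finset.mem_filter]
                constructor
                · rintro ⟨hz, hq⟩
                  refine ⟨⟨hz, ?_⟩, ?_⟩
                  · have := hq (par n) (by have := hpar n; omega) (by have := hpar n; omega)
                    rw [Function.update_of_ne (by have := hpar n; omega), hv] at this
                    exact this
                  · intro q hqn _
                    have := hq q (by omega) (by omega)
                    rwa [Function.update_of_ne (by omega)] at this
                · rintro ⟨⟨hz, hzv⟩, hq⟩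
                  refine ⟨hz, fun q hqn hqne => ?_⟩
                  rw [Function.update_of_ne hqne]
                  by_cases hqp : q = par n
                  · rw [hqp, hv]; exact hzv
                  · exact hq q (by omega) hqp
              rw [hrem]
              split_ifs with c1 c2
              · exact le_rfl
              · exfalso
                apply c2
                have : (remain G n (par n) φ (outside G S v)).card * (2 * t) ^ n * (2 * t) <
                    (outside G S v).card * (2 * t) := by
                  calc _ = (remain G n (par n) φ (outside G S v)).card * (2 * t) ^ (n + 1) := by ring
                    _ < S.card := c1
                    _ ≤ _ := hbad
                exact Nat.lt_of_mul_lt_mul_right this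
              · exact zero_le_one
              · exact le_rfl
            · simp [hv]
          rw [add_zero, one_div, inv_mul_le_iff₀ (hpv v)]
          linarith
      refine (Finset.sum_le_sum key).trans ?_
      rw [Finset.sum_add_distrib, Finset.sum_const, card_neighborFinset_eq_degree, nsmul_eq_mul,
        Finset.sum_boole]
      have hc : ((G.neighborFinset u).filter fun v =>
          (outside G S v).card * (2 * t) < S.card).card ≤ t := by
        refine le_trans (Finset.card_le_card ?_) (few_bad G t hK S ?_)
        · exact Finset.filter_subset_filter _ (Finset.subset_univ _)
        · refine le_trans ?_ hS
          exact Nat.le_mul_of_pos_right _ (by positivity)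
      have hc' : (((G.neighborFinset u).filter fun v =>
          (outside G S v).card * (2 * t) < S.card).card : ℝ) ≤ t := by exact_mod_cast hc
      have : (t : ℝ) ≤ (t : ℝ) / D * G.degree u := by
        rw [div_mul_eq_mul_div, le_div_iff₀ hDR]
        exact mul_le_mul_of_nonneg_left (hDv u) (Nat.cast_nonneg _)
      push_cast
      linarith
    · have hpn : p ≤ n := by omega
      have hS' : 4 * t * (2 * t) ^ n ≤ S.card := by
        refine le_trans ?_ hS
        exact Nat.mul_le_mul_left _ (Nat.pow_le_pow_right (by omega) (by omega))
      have h1 := ih p hpn u S hS'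
      have h2 := treeE_mass G par hpar n p hpn u
      have h3 : treeE G par (n + 1) (fun φ => if φ p = u then
          (if (remain G (n + 1) p φ S).card * (2 * t) ^ (n + 1) < S.card then 1 else 0) else 0) ≤
          treeE G par n (fun φ => (if φ p = u then
          (if (remain G n p φ S).card * (2 * t) ^ n < S.card then 1 else 0) else 0) +
          (t : ℝ) / D * (if φ p = u then 1 else 0)) := by
        refine treeE_mono G par n _ _ fun φ => ?_
        simp only [Function.update_of_ne h]
        by_cases hu : φ p = u
        · simp only [hu, if_true, mul_one]
          rw [div_le_iff₀ (hpv _), Finset.sum_boole]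
          split_ifs with hb
          · have : (((G.neighborFinset (φ (par n))).filter fun z =>
              (remain G (n + 1) p (Function.update φ (n + 1) z) S).card * (2 * t) ^ (n + 1)
                < S.card).card : ℝ) ≤ G.degree (φ (par n)) := by
              exact_mod_cast (Finset.card_filter_le _ _).trans
                (card_neighborFinset_eq_degree G _).le
            have : 0 ≤ (t : ℝ) / D * G.degree (φ (par n)) := by positivity
            linarith
          · push Not at hb
            have hS2 : 4 * t ≤ (remain G n p φ S).card := by
              have : 4 * t * (2 * t) ^ n ≤ (remain G n p φ S).card * (2 * t) ^ n := hS'.trans hb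
              exact Nat.le_of_mul_le_mul_right this (by positivity)
            have hc : ((G.neighborFinset (φ (par n))).filter fun z =>
              (remain G (n + 1) p (Function.update φ (n + 1) z) S).card * (2 * t) ^ (n + 1)
                < S.card).card ≤ t := by
              refine le_trans (Finset.card_le_card ?_) (few_bad G t hK (remain G n p φ S) hS2)
              intro z hz
              simp only [Finset.mem_filter, Finset.mem_univ, true_and] at hz ⊢
              have hrem : remain G (n + 1) p (Function.update φ (n + 1) z) S =
                  outside G (remain G n p φ S) z := by
                ext w
                simp only [remain, outside, Finset.mem_filter]
                constructor
                · rintro ⟨hw, hq⟩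
                  refine ⟨⟨hw, fun q hqn hqp => ?_⟩, ?_⟩
                  · have := hq q (by omega) hqp
                    rwa [Function.update_of_ne (by omega)] at this
                  · have := hq (n + 1) le_rfl (Ne.symm h)
                    rwa [Function.update_self] at this
                · rintro ⟨⟨hw, hq⟩, hwz⟩
                  refine ⟨hw, fun q hqn hqp => ?_⟩
                  by_cases hqn1 : q = n + 1
                  · subst hqn1; rw [Function.update_self]; exact hwz
                  · rw [Function.update_of_ne hqn1]
                    exact hq q (by omega) hqp
              have hz2 := hz.2
              rw [hrem] at hz2
              have : (outside G (remain G n p φ S) z).card * (2 * t) * (2 * t) ^ n <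
                  (remain G n p φ S).card * (2 * t) ^ n := by
                calc _ = (outside G (remain G n p φ S) z).card * (2 * t) ^ (n + 1) := by ring
                  _ < _ := hz2
                  _ ≤ _ := hb
              exact Nat.lt_of_mul_lt_mul_right this
            have hc' : (((G.neighborFinset (φ (par n))).filter fun z =>
              (remain G (n + 1) p (Function.update φ (n + 1) z) S).card * (2 * t) ^ (n + 1)
                < S.card).card : ℝ) ≤ t := by exact_mod_cast hc
            have : (t : ℝ) ≤ (t : ℝ) / D * G.degree (φ (par n)) := by
              rw [div_mul_eq_mul_div, le_div_iff₀ hDR]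
              exact mul_le_mul_of_nonneg_left (hDv _) (Nat.cast_nonneg _)
            linarith
        · simp [hu]
      rw [treeE_add, treeE_mul] at h3
      have h4 : (t : ℝ) / D * treeE G par n (fun φ => if φ p = u then 1 else 0) ≤
          (t : ℝ) / D * G.degree u := mul_le_mul_of_nonneg_left h2 (by positivity)
      push_cast
      linarith

/-- `φ` restricted to `0, …, n` is an induced embedding of the tree given by `par`. -/
def IndTree (n : ℕ) (φ : ℕ → V) : Prop :=
  ∀ k < n, ∀ q ≤ k, φ (k + 1) ≠ φ q ∧ (G.Adj (φ (k + 1)) (φ q) ↔ q = par k)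

lemma indTree_mass (t D N : ℕ) (ht : 1 ≤ t) (hD : (2 * t) ^ (N ^ 2 + N + 2) ≤ D)
    (hdeg : ∀ v, D ≤ G.degree v)
    (hK : ¬ ContainsKtt G t) (hpar : ∀ n, par n ≤ n) (n : ℕ) (hn : n ≤ N) :
    (∑ v, (G.degree v : ℝ)) ≤
      (2 * t : ℝ) ^ (n ^ 2) * treeE G par n (fun φ => if IndTree G par n φ then 1 else 0) := by
  have hD1 : 1 ≤ D := le_trans (Nat.one_le_pow _ _ (by omega)) hD
  have hDR : (0 : ℝ) < D := by exact_mod_cast hD1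
  have hDv : ∀ v, (D : ℝ) ≤ G.degree v := fun v => by exact_mod_cast hdeg v
  have hpv : ∀ v, (0 : ℝ) < G.degree v := fun v => hDR.trans_le (hDv v)
  have htR : (1 : ℝ) ≤ t := by exact_mod_cast ht
  set Z := ∑ v, (G.degree v : ℝ) with hZ
  have hZ0 : 0 ≤ Z := Finset.sum_nonneg fun v _ => Nat.cast_nonneg _
  induction n with
  | zero => simp [treeE, IndTree, hZ]
  | succ n ih =>
    have ih := ih (by omega)
    set I := treeE G par n (fun φ => if IndTree G par n φ then 1 else 0) with hI
    -- the bad event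
    have hbad : treeE G par n (fun φ => ∑ u, if φ (par n) = u then
        (if (remain G n (par n) φ (G.neighborFinset u)).card * (2 * t) ^ n
          < (G.neighborFinset u).card then 1 else 0) else 0) ≤ n * ((t : ℝ) / D) * Z := by
      rw [treeE_sum, hZ, Finset.mul_sum]
      refine Finset.sum_le_sum fun u _ => ?_
      refine remain_bad G par t D ht hD1 hdeg hK hpar n (par n) (hpar n) u _ ?_
      rw [card_neighborFinset_eq_degree]
      refine le_trans ?_ (hD.trans (hdeg u))
      calc 4 * t * (2 * t) ^ n ≤ (2 * t) ^ 2 * (2 * t) ^ n := by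
            refine Nat.mul_le_mul_right _ ?_
            nlinarith
        _ = (2 * t) ^ (n + 2) := by ring
        _ ≤ _ := Nat.pow_le_pow_right (by omega) (by nlinarith)
    set J := treeE G par (n + 1) (fun φ => if IndTree G par (n + 1) φ then 1 else 0) with hJ
    have hstep : I ≤ (2 * t : ℝ) ^ n * J + n * ((t : ℝ) / D) * Z := by
      have : I ≤ treeE G par n (fun φ => (2 * t : ℝ) ^ n *
          ((∑ z ∈ G.neighborFinset (φ (par n)),
            (if IndTree G par (n + 1) (Function.update φ (n + 1) z) then (1 : ℝ) else 0)) /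
              (G.degree (φ (par n)) : ℝ)) +
          ∑ u, if φ (par n) = u then
        (if (remain G n (par n) φ (G.neighborFinset u)).card * (2 * t) ^ n
          < (G.neighborFinset u).card then 1 else 0) else 0) := by
        refine treeE_mono G par n _ _ fun φ => ?_
        rw [Finset.sum_ite_eq]
        simp only [Finset.mem_univ, if_true]
        have hnn : 0 ≤ (2 * t : ℝ) ^ n *
          ((∑ z ∈ G.neighborFinset (φ (par n)),
            (if IndTree G par (n + 1) (Function.update φ (n + 1) z) then (1 : ℝ) else 0)) /
              (G.degree (φ (par n)) : ℝ)) := by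
          refine mul_nonneg (by positivity) (div_nonneg (Finset.sum_nonneg fun z _ => ?_)
            (Nat.cast_nonneg _))
          split_ifs <;> simp
        by_cases hb : (remain G n (par n) φ (G.neighborFinset (φ (par n)))).card * (2 * t) ^ n
          < (G.neighborFinset (φ (par n))).card
        · simp only [hb, if_true]
          split_ifs <;> linarith
        · simp only [hb, if_false, add_zero]
          split_ifs with hind
          · push Not at hb
            rw [Finset.sum_boole, ← mul_div_assoc, le_div_iff₀ (hpv _), one_mul]
            have hsub : remain G n (par n) φ (G.neighborFinset (φ (par n))) ⊆
                (G.neighborFinset (φ (par n))).filter fun z =>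
                  IndTree G par (n + 1) (Function.update φ (n + 1) z) := by
              intro z hz
              simp only [remain, Finset.mem_filter, mem_neighborFinset] at hz ⊢
              refine ⟨hz.1, ?_⟩
              intro k hk q hq
              rw [Function.update_of_ne (show q ≠ n + 1 by omega)]
              by_cases hkn : k = n
              · subst hkn
                rw [Function.update_self]
                by_cases hqp : q = par k
                · subst hqp
                  exact ⟨hz.1.ne', by simp [hz.1.symm]⟩
                · have := hz.2 q hq hqp
                  refine ⟨this.1, ?_⟩
                  simp only [hqp, iff_false]
                  exact fun hh => this.2 hh.symm
              · rw [Function.update_of_ne (show k + 1 ≠ n + 1 by omega)]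
                exact hind k (by omega) q hq
            have hc := Finset.card_le_card hsub
            rw [card_neighborFinset_eq_degree] at hb
            have hb2 := hb.trans (Nat.mul_le_mul_right ((2 * t) ^ n) hc)
            have hb3 : (G.degree (φ (par n)) : ℝ) ≤ (((G.neighborFinset (φ (par n))).filter fun z =>
                  IndTree G par (n + 1) (Function.update φ (n + 1) z)).card : ℝ) *
                  (2 * t : ℝ) ^ n := by exact_mod_cast hb2
            linarith
          · exact hnn
      rw [treeE_add, treeE_mul] at this
      have hJ' : J = treeE G par n (fun φ => (∑ z ∈ G.neighborFinset (φ (par n)),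
            (if IndTree G par (n + 1) (Function.update φ (n + 1) z) then (1 : ℝ) else 0)) /
              (G.degree (φ (par n)) : ℝ)) := rfl
      rw [hJ']
      linarith
    have hJ0 : 0 ≤ J := by
      have h0 := treeE_mul G par (n + 1) 0 (fun _ => 0)
      have h1 := treeE_mono G par (n + 1) (fun _ => (0 : ℝ) * 0)
        (fun φ => if IndTree G par (n + 1) φ then 1 else 0)
        (fun φ => by split_ifs <;> simp)
      rw [h0, zero_mul] at h1
      exact h1
    -- numerics
    have hnum : (2 * t : ℝ) ^ (n ^ 2) * (n * ((t : ℝ) / D)) ≤ 1 / 2 := by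
      have hn2 : (n : ℝ) ≤ (2 * t : ℝ) ^ n := by
        have : n ≤ (2 * t) ^ n := (Nat.lt_pow_self (by omega)).le
        exact_mod_cast this
      have hDD : (2 * t : ℝ) ^ (n ^ 2 + n + 1) ≤ D := by
        have : (2 * t) ^ (n ^ 2 + n + 1) ≤ D :=
          le_trans (Nat.pow_le_pow_right (by omega) (by nlinarith)) hD
        exact_mod_cast this
      have e : (2 * t : ℝ) ^ (n ^ 2) * (n * ((t : ℝ) / D)) =
        ((2 * t : ℝ) ^ (n ^ 2) * n * t) / D := by ring
      rw [e, div_le_iff₀ hDR]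
      calc (2 * t : ℝ) ^ (n ^ 2) * n * t ≤ (2 * t : ℝ) ^ (n ^ 2) * (2 * t : ℝ) ^ n * t := by
            gcongr
        _ = 1 / 2 * (2 * t : ℝ) ^ (n ^ 2 + n + 1) := by ring
        _ ≤ _ := by linarith
    have h5 : Z ≤ (2 * t : ℝ) ^ (n ^ 2) * (2 * t : ℝ) ^ n * J + 1 / 2 * Z := by
      calc Z ≤ (2 * t : ℝ) ^ (n ^ 2) * I := ih
        _ ≤ (2 * t : ℝ) ^ (n ^ 2) * ((2 * t : ℝ) ^ n * J + n * ((t : ℝ) / D) * Z) :=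
            mul_le_mul_of_nonneg_left hstep (by positivity)
        _ = (2 * t : ℝ) ^ (n ^ 2) * (2 * t : ℝ) ^ n * J +
            (2 * t : ℝ) ^ (n ^ 2) * (n * ((t : ℝ) / D)) * Z := by ring
        _ ≤ _ := by
          have := mul_le_mul_of_nonneg_right hnum hZ0
          linarith
    calc Z ≤ 2 * ((2 * t : ℝ) ^ (n ^ 2) * (2 * t : ℝ) ^ n * J) := by linarith
      _ ≤ (2 * t : ℝ) * ((2 * t : ℝ) ^ (n ^ 2) * (2 * t : ℝ) ^ n * J) := by
          refine mul_le_mul_of_nonneg_right (by linarith) (by positivity)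
      _ = (2 * t : ℝ) ^ (n ^ 2 + n + 1) * J := by ring
      _ ≤ (2 * t : ℝ) ^ ((n + 1) ^ 2) * J := by
          refine mul_le_mul_of_nonneg_right ?_ hJ0
          exact pow_le_pow_right₀ (by linarith) (by nlinarith)

lemma exists_indTree [Nonempty V] (t D N : ℕ) (ht : 1 ≤ t)
    (hD : (2 * t) ^ (N ^ 2 + N + 2) ≤ D) (hdeg : ∀ v, D ≤ G.degree v)
    (hK : ¬ ContainsKtt G t) (hpar : ∀ n, par n ≤ n) :
    ∃ φ : ℕ → V, IndTree G par N φ := by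
  by_contra! hcon
  have h := indTree_mass G par t D N ht hD hdeg hK hpar N le_rfl
  have h0 : treeE G par N (fun _ => (0 : ℝ)) = 0 := by
    have := treeE_mul G par N 0 (fun _ => 0)
    simpa using this
  simp only [hcon, if_false, h0, mul_zero] at h
  have hD1 : 1 ≤ D := le_trans (Nat.one_le_pow _ _ (by omega)) hD
  have : 0 < ∑ v, (G.degree v : ℝ) := by
    refine Finset.sum_pos (fun v _ => ?_) Finset.univ_nonempty
    have := hdeg v
    exact_mod_cast (by omega : 0 < G.degree v)
  linarith

end TreeWalk

open Classical in
lemma colorable_of_degeneracy {V : Type*} [Fintype V] (G : SimpleGraph V) (d : ℕ)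
    (h : DegeneracyAtMost G d) : G.Colorable (d + 1) := by
  have key : ∀ m : ℕ, ∀ s : Finset V, s.card = m →
      ∃ f : V → Fin (d + 1), ∀ a ∈ s, ∀ b ∈ s, G.Adj a b → f a ≠ f b := by
    intro m
    induction m with
    | zero =>
      intro s hs
      rw [Finset.card_eq_zero] at hs
      subst hs
      exact ⟨fun _ => 0, by simp⟩
    | succ m ih =>
      intro s hs
      have hne : s.Nonempty := Finset.card_pos.mp (by omega)
      obtain ⟨v, hv, hdv⟩ := h ((⊤ : G.Subgraph).induce (s : Set V)) (by simpa using hne)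
      replace hv : v ∈ s := hv
      obtain ⟨f, hf⟩ := ih (s.erase v) (by rw [Finset.card_erase_of_mem hv]; omega)
      have hset : (((⊤ : G.Subgraph).induce (s : Set V)).neighborSet v) =
          ((s.filter fun w => G.Adj v w : Finset V) : Set V) := by
        ext w
        simp [hv]
      rw [hset, Set.ncard_coe_finset] at hdv
      obtain ⟨c, hc⟩ : ∃ c : Fin (d + 1), c ∉ (s.filter fun w => G.Adj v w).image f := by
        by_contra! hcon
        have h1 : (Finset.univ : Finset (Fin (d + 1))).card ≤
            ((s.filter fun w => G.Adj v w).image f).card :=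
          Finset.card_le_card fun c _ => hcon c
        have h2 := Finset.card_image_le (s := s.filter fun w => G.Adj v w) (f := f)
        simp at h1
        omega
      have hc' : ∀ w ∈ s, G.Adj v w → f w ≠ c := by
        intro w hw hvw hfc
        exact hc (Finset.mem_image.mpr ⟨w, Finset.mem_filter.mpr ⟨hw, hvw⟩, hfc⟩)
      refine ⟨Function.update f v c, ?_⟩
      intro a ha b hb hab
      by_cases hav : a = v <;> by_cases hbv : b = v
      · subst hav; subst hbv; exact absurd hab (G.irrefl)
      · subst hav
        simp only [Function.update_self, Function.update_of_ne hbv]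
        exact (hc' b hb hab).symm
      · subst hbv
        simp only [Function.update_self, Function.update_of_ne hav]
        exact hc' a ha hab.symm
      · simp only [Function.update_of_ne hav, Function.update_of_ne hbv]
        exact hf a (Finset.mem_erase.mpr ⟨hav, ha⟩) b (Finset.mem_erase.mpr ⟨hbv, hb⟩) hab
  obtain ⟨f, hf⟩ := key _ Finset.univ rfl
  exact ⟨SimpleGraph.Coloring.mk f fun {a b} hab =>
    hf a (Finset.mem_univ _) b (Finset.mem_univ _) hab⟩

open Classical in
lemma forest_nat {W : Type*} [Finite W] (H : SimpleGraph W) (hH : H.IsAcyclic) :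
    ∃ c : ℕ, 0 < c ∧ ∀ (V : Type) [Fintype V] (G : SimpleGraph V),
      IsInducedFree G H → ∀ t : ℕ, 1 ≤ t →
        ContainsKtt G t ∨ ∃ D : ℕ, D + 1 ≤ t ^ c ∧ DegeneracyAtMost G D := by
  obtain ⟨N, par, f, hpar, hfN, hinj, hadj⟩ := forest_embed H hH
  refine ⟨2 * (N ^ 2 + N + 2), by positivity, ?_⟩
  intro V _ G hfree t ht
  by_contra! hcon
  obtain ⟨hK, hdeg⟩ := hcon
  rcases Nat.lt_or_ge t 2 with ht2 | ht2
  · have ht1 : t = 1 := by omega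
    subst ht1
    refine hdeg 0 (by simp) ?_
    intro H' hne
    obtain ⟨v, hv⟩ := hne
    refine ⟨v, hv, ?_⟩
    have : H'.neighborSet v = ∅ := by
      ext w
      simp only [Subgraph.mem_neighborSet, mem_empty_iff_false, iff_false]
      intro hvw
      have had := hvw.adj_sub
      exact hK ⟨{v}, {w}, by simp, by simp, by simpa using had.ne, by simpa using had⟩
    simp [this]
  have hpos : 1 ≤ t ^ (2 * (N ^ 2 + N + 2)) := Nat.one_le_pow _ _ ht
  have hnd := hdeg (t ^ (2 * (N ^ 2 + N + 2)) - 1) (by omega)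
  unfold DegeneracyAtMost at hnd
  push Not at hnd
  obtain ⟨H', hne, hH'⟩ := hnd
  have : Nonempty H'.verts := hne.to_subtype
  have hD : (2 * t) ^ (N ^ 2 + N + 2) ≤ t ^ (2 * (N ^ 2 + N + 2)) := by
    rw [pow_mul]
    exact Nat.pow_le_pow_left (by nlinarith) _
  obtain ⟨φ, hφ⟩ := exists_indTree (G.induce H'.verts) par t _ N ht hD (by
      intro v
      have h1 := hH' v v.2
      have h2 : (H'.neighborSet v) ⊆ Subtype.val '' ((G.induce H'.verts).neighborSet v) := by
        intro w hw
        exact ⟨⟨w, H'.edge_vert hw.symm⟩, hw.adj_sub, rfl⟩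
      have h3 := Set.ncard_le_ncard h2 (Set.toFinite _)
      rw [Set.ncard_image_of_injective _ Subtype.val_injective,
        Set.ncard_eq_toFinset_card' ((G.induce H'.verts).neighborSet v),
        ← neighborFinset_def, card_neighborFinset_eq_degree] at h3
      have h5 : t ^ (2 * (N ^ 2 + N + 2)) ≤ (H'.neighborSet v).ncard := by omega
      refine (h5.trans h3).trans (le_of_eq ?_)
      congr!) (by
      rintro ⟨A, B, hA, hB, hAB, hadj'⟩
      refine hK ⟨A.map (Function.Embedding.subtype _), B.map (Function.Embedding.subtype _),
        by simpa using hA, by simpa using hB, ?_, ?_⟩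
      · rwa [Finset.disjoint_map]
      · intro a ha b hb
        obtain ⟨a', ha', rfl⟩ := Finset.mem_map.mp ha
        obtain ⟨b', hb', rfl⟩ := Finset.mem_map.mp hb
        exact hadj' a' ha' b' hb') hpar
  have hlt : ∀ a b : W, f b < f a →
      φ (f a) ≠ φ (f b) ∧ (G.Adj (φ (f a)) (φ (f b)) ↔ H.Adj a b) := by
    intro a b hab
    obtain ⟨k, hk⟩ : ∃ k, f a = k + 1 := ⟨f a - 1, by omega⟩
    have h1 := hφ k (by have := hfN a; omega) (f b) (by omega)
    rw [hadj a b k hk (by omega), hk]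
    exact h1
  have hne' : ∀ a b : W, a ≠ b →
      φ (f a) ≠ φ (f b) ∧ (G.Adj (φ (f a)) (φ (f b)) ↔ H.Adj a b) := by
    intro a b hab
    rcases lt_or_gt_of_ne (fun e => hab (hinj e) : f a ≠ f b) with h | h
    · have := hlt b a h
      exact ⟨this.1.symm, by rw [G.adj_comm, H.adj_comm]; exact this.2⟩
    · exact hlt a b h
  let e : H ↪g G :=
    { toFun := fun a => (φ (f a) : V)
      inj' := by
        intro a b hab
        by_contra hne
        exact (hne' a b hne).1 (Subtype.ext hab)
      map_rel_iff' := by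
        intro a b
        by_cases hab : a = b
        · subst hab; simp
        · exact (hne' a b hab).2 }
  refine hfree (Set.range e) ⟨RelIso.symm ?_⟩
  exact
    { toEquiv := Equiv.ofInjective e e.injective
      map_rel_iff' := by
        intro a b
        exact e.map_rel_iff }

/-- For every forest `H` there exists `c > 0` such that every `H`-free graph `G` either
contains `K_{t,t}` as a subgraph, or has degeneracy less than `t^c` and hence chromatic
number at most `t^c`. -/
theorem forest_Ktt_or_degenerate (W : Type) [Fintype W] (H : SimpleGraph W)
    (hH : H.IsAcyclic) :
    ∃ c : ℝ, 0 < c ∧ ∀ (V : Type) [Fintype V] (G : SimpleGraph V),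
      IsInducedFree G H → ∀ t : ℕ,
        ContainsKtt G t ∨
        ((∃ D : ℕ, (D : ℝ) < (t : ℝ) ^ c ∧ DegeneracyAtMost G D) ∧
          G.chromaticNumber ≤ ((⌊(t : ℝ) ^ c⌋₊ : ℕ) : ℕ∞)) := by
  obtain ⟨c, hc, h⟩ := forest_nat H hH
  refine ⟨c, by exact_mod_cast hc, ?_⟩
  intro V _ G hfree t
  rcases Nat.eq_zero_or_pos t with ht | ht
  · subst ht
    exact Or.inl ⟨∅, ∅, by simp⟩
  · rcases h V G hfree t ht with h1 | ⟨D, hD, hdeg⟩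
    · exact Or.inl h1
    · right
      rw [Real.rpow_natCast]
      refine ⟨⟨D, ?_, hdeg⟩, ?_⟩
      · have : D < t ^ c := by omega
        exact_mod_cast this
      · have hfl : ⌊(t : ℝ) ^ c⌋₊ = t ^ c := by
          rw [← Nat.cast_pow, Nat.floor_natCast]
        rw [hfl]
        exact ((colorable_of_degeneracy G D hdeg).mono hD).chromaticNumber_le
end
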